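/- Let T ⊂ ℙ²(ℝ) be a set of exactly 8 points such that no 4 points of T lie on a line and no 7 points of T lie on a conic. Then there exists a homogeneous polynomial g ∈ ℝ[x₀,x₁,x₂] of degree 6 that is nonnegative on all of ℝ³, vanishes at every point of T, and is not a finite sum of squares of polynomials. -/

import Mathlib

open MvPolynomial

noncomputable section

/-- The real projective plane, as lines through the origin of `ℝ³`. -/
abbrev P2 := Projectivization ℝ (Fin 3 → ℝ)

/-- A polynomial is psd if it takes only nonnegative values on `ℝ³`. -/
def Psd (g : MvPolynomial (Fin 3) ℝ) : Prop := ∀ u : Fin 3 → ℝ, 0 ≤ eval u g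

/-- A polynomial is sos if it is a finite sum of squares. -/
def Sos (g : MvPolynomial (Fin 3) ℝ) : Prop :=
  ∃ (n : ℕ) (h : Fin n → MvPolynomial (Fin 3) ℝ), g = ∑ i, (h i) ^ 2

/-- A form vanishes at a point of `ℙ²(ℝ)` if it vanishes at a representative vector. -/
def VanishAt (g : MvPolynomial (Fin 3) ℝ) (P : P2) : Prop := eval P.rep g = 0

/-- A form is singular at a point of `ℙ²(ℝ)` if it and all its first partial
derivatives vanish at a representative vector. -/
def SingAt (g : MvPolynomial (Fin 3) ℝ) (P : P2) : Prop :=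
  eval P.rep g = 0 ∧ ∀ i, eval P.rep (pderiv i g) = 0

/-- `I_d(T)`: the space of degree-`d` forms vanishing at every point of `T`. -/
def Isub (d : ℕ) (T : Set P2) : Submodule ℝ (MvPolynomial (Fin 3) ℝ) :=
  (homogeneousSubmodule (Fin 3) ℝ d) ⊓
  { carrier := {f | ∀ P ∈ T, VanishAt f P}
    zero_mem' := by intro P _; simp [VanishAt]
    add_mem' := by
      intro a b ha hb P hP
      have h1 := ha P hP; have h2 := hb P hP
      unfold VanishAt at *; simp [h1, h2]
    smul_mem' := by
      intro c f hf P hP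
      have h1 := hf P hP
      unfold VanishAt at *; simp [smul_eq_C_mul, h1] }

/-- `I_d(2T)`: the space of degree-`d` forms singular at every point of `T`. -/
def Isub2 (d : ℕ) (T : Set P2) : Submodule ℝ (MvPolynomial (Fin 3) ℝ) :=
  (homogeneousSubmodule (Fin 3) ℝ d) ⊓
  { carrier := {f | ∀ P ∈ T, SingAt f P}
    zero_mem' := by intro P _; constructor <;> simp [SingAt]
    add_mem' := by
      intro a b ha hb P hP
      obtain ⟨h1, h2⟩ := ha P hP; obtain ⟨h3, h4⟩ := hb P hP
      exact ⟨by simp [h1, h3], fun i => by simp [h2 i, h4 i]⟩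
    smul_mem' := by
      intro c f hf P hP
      obtain ⟨h1, h2⟩ := hf P hP
      refine ⟨by simp [smul_eq_C_mul, h1], fun i => ?_⟩
      have := h2 i
      simp [smul_eq_C_mul, this] }

/-- `I₃(T)²`: the span of products of two cubics vanishing on `T`. -/
def IsqCubic (T : Set P2) : Submodule ℝ (MvPolynomial (Fin 3) ℝ) :=
  Submodule.span ℝ {h | ∃ f₁ ∈ Isub 3 T, ∃ f₂ ∈ Isub 3 T, h = f₁ * f₂}

/-- No 4 points of `T` on a line, no 7 on a conic. -/
def GenPos (T : Set P2) : Prop :=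
  (∀ l : MvPolynomial (Fin 3) ℝ, l ≠ 0 → l.IsHomogeneous 1 →
    {P ∈ T | VanishAt l P}.encard ≤ 3) ∧
  (∀ c : MvPolynomial (Fin 3) ℝ, c ≠ 0 → c.IsHomogeneous 2 →
    {P ∈ T | VanishAt c P}.encard ≤ 6)

/-- The real projective zero set of `g`. -/
def VR (g : MvPolynomial (Fin 3) ℝ) : Set P2 := {P | VanishAt g P}


section

abbrev Pt := Fin 3 → ℝ
abbrev R3 := MvPolynomial (Fin 3) ℝ
abbrev HH (n : ℕ) : Submodule ℝ R3 := homogeneousSubmodule (Fin 3) ℝ n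

lemma finrank_HH (n : ℕ) : Module.finrank ℝ (HH n) = (n + 2).choose n := by
  have h1 : HH n = AddMonoidAlgebra.supported _ ℝ {d | d.degree = n} :=
    homogeneousSubmodule_eq_finsupp_supported (Fin 3) ℝ n
  have h2 : {d : Fin 3 →₀ ℕ | d.degree = n}
      = ((Finset.univ : Finset (Fin 3)).finsuppAntidiag n : Set (Fin 3 →₀ ℕ)) := by
    ext d
    simp [Finset.mem_finsuppAntidiag, Finsupp.degree_eq_sum]
  have e := AddMonoidAlgebra.supportedEquivFinsupp (R := ℝ) (S := ℝ) {d : Fin 3 →₀ ℕ | d.degree = n}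
  rw [← h1] at e
  rw [e.finrank_eq]
  have : Fintype {d : Fin 3 →₀ ℕ | d.degree = n} := by rw [h2]; infer_instance
  rw [Module.finrank_finsupp_self, ← Nat.card_eq_fintype_card, h2]
  rw [Nat.card_coe_set_eq, Set.ncard_coe_finset, Finset.card_finsuppAntidiag_nat_eq_choose]
  simp
  congr 1; omega

instance (n : ℕ) : Module.Finite ℝ (HH n) :=
  Module.Finite.iff_fg.mpr (homogeneousSubmodule_fg _ _ n)

lemma surj_of_tri {V : Type*} [AddCommGroup V] [Module ℝ V] {n : ℕ} (φ : V →ₗ[ℝ] (Fin n → ℝ))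
    (h : ∀ k, ∃ v, φ v k ≠ 0 ∧ ∀ j, j < k → φ v j = 0) : Function.Surjective φ := by
  choose v hv hv0 using h
  have hM : (Matrix.of fun k j => φ (v k) j).det ≠ 0 := by
    rw [Matrix.det_of_isUpperTriangular]
    · exact Finset.prod_ne_zero_iff.mpr fun i _ => hv i
    · intro i j hij
      exact hv0 i j hij
  have hu := (Matrix.isUnit_iff_isUnit_det _).mpr (isUnit_iff_ne_zero.mpr hM)
  intro y
  obtain ⟨x, hx⟩ := (Matrix.vecMul_surjective_iff_isUnit.mpr hu) y
  refine ⟨∑ k, x k • v k, ?_⟩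
  rw [← hx]
  ext j
  simp [Matrix.vecMul, dotProduct]

/-- Restriction of a linear functional tuple to forms of degree n. -/
def res {ι : Type*} (n : ℕ) (φ : R3 →ₗ[ℝ] (ι → ℝ)) : HH n →ₗ[ℝ] (ι → ℝ) :=
  φ ∘ₗ (HH n).subtype

lemma exists_form {ι : Type*} [Fintype ι] (n : ℕ) (φ : R3 →ₗ[ℝ] (ι → ℝ))
    (h : Fintype.card ι < (n + 2).choose n) : ∃ f : R3, f ≠ 0 ∧ f.IsHomogeneous n ∧ φ f = 0 := by
  have : ∃ x, x ≠ 0 ∧ res n φ x = 0 := by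
    by_contra hcon
    push Not at hcon
    have hinj : Function.Injective (res n φ) := by
      rw [injective_iff_map_eq_zero]
      intro a ha
      by_contra h0
      exact hcon a h0 ha
    have := LinearMap.finrank_le_finrank_of_injective hinj
    rw [finrank_HH, Module.finrank_fintype_fun_eq_card] at this
    omega
  obtain ⟨x, hx, h0⟩ := this
  exact ⟨x, by simpa using hx, x.2, h0⟩

lemma finrank_ker {n m : ℕ} (φ : HH n →ₗ[ℝ] (Fin m → ℝ)) (h : Function.Surjective φ) :
    Module.finrank ℝ (LinearMap.ker φ) + m = (n + 2).choose n := by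
  have := φ.finrank_range_add_finrank_ker
  rw [finrank_HH, LinearMap.range_eq_top.mpr h, finrank_top, Module.finrank_fintype_fun_eq_card] at this
  simp at this
  omega

/-- evaluation as a linear map -/
def ev (a : Pt) : R3 →ₗ[ℝ] ℝ := (aeval a).toLinearMap

lemma ev_apply (a : Pt) (f : R3) : ev a f = eval a f := by
  simp [ev, aeval_eq_eval]

/-- directional derivative functional -/
def dd (a v : Pt) : R3 →ₗ[ℝ] ℝ := ∑ k, v k • (ev a ∘ₗ (pderiv k).toLinearMap)

lemma dd_apply (a v : Pt) (f : R3) : dd a v f = ∑ k, v k * eval a (pderiv k f) := by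
  simp [dd, ev_apply]

lemma dd_mul (a v : Pt) (f g : R3) :
    dd a v (f * g) = dd a v f * eval a g + eval a f * dd a v g := by
  simp only [dd_apply, Fin.sum_univ_three, pderiv_mul, map_add, map_mul]
  ring

def lin (n : Pt) : R3 := ∑ i, C (n i) * X i

lemma eval_lin (n x : Pt) : eval x (lin n) = n 0 * x 0 + n 1 * x 1 + n 2 * x 2 := by
  simp [lin, Fin.sum_univ_three]

lemma dd_lin (a v n : Pt) : dd a v (lin n) = eval v (lin n) := by
  simp [lin, dd_apply, Fin.sum_univ_three, pderiv_mul, pderiv_X, Pi.single_apply]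
  ring

lemma lin_hom (n : Pt) : (lin n).IsHomogeneous 1 := by
  apply IsHomogeneous.sum
  intro i _
  simpa using (isHomogeneous_X ℝ i).C_mul (n i)

lemma hom_ev {n : ℕ} {f : R3} (hf : f.IsHomogeneous n) (c : ℝ) (x : Pt) :
    eval (c • x) f = c ^ n * eval x f := by
  rw [eval_eq, eval_eq, Finset.mul_sum]
  refine Finset.sum_congr rfl fun d hd => ?_
  have h := hf.degree_eq_sum_deg_support hd
  simp only [Pi.smul_apply, smul_eq_mul, mul_pow, Finset.prod_mul_distrib, Finset.prod_pow_eq_pow_sum]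
  rw [← h]; ring

lemma lin_ne {n : Pt} (h : n ≠ 0) : lin n ≠ 0 := by
  intro h0
  apply h
  have : ∀ i, coeff (Finsupp.single i 1) (lin n) = n i := by
    intro i
    rw [lin, coeff_sum]
    simp [coeff_C_mul, coeff_X, coeff_X', Finsupp.single_left_inj]
  ext i
  rw [← this, h0]; simp

lemma lin_surj {l : R3} (hl : l.IsHomogeneous 1) : ∃ n, l = lin n := by
  have : l ∈ HH 1 := hl
  rw [HH, homogeneousSubmodule_one_eq_span_X, Submodule.mem_span_range_iff_exists_fun] at this
  obtain ⟨c, hc⟩ := this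
  exact ⟨c, by rw [← hc]; simp [lin, smul_eq_C_mul]⟩

/-- determinant of three vectors -/
def dt (a b c : Pt) : ℝ :=
  (a 1 * b 2 - a 2 * b 1) * c 0 + (a 2 * b 0 - a 0 * b 2) * c 1 + (a 0 * b 1 - a 1 * b 0) * c 2

def cr (a b : Pt) : Pt := ![a 1 * b 2 - a 2 * b 1, a 2 * b 0 - a 0 * b 2, a 0 * b 1 - a 1 * b 0]

/-- non-proportional -/
def Np (a b : Pt) : Prop := cr a b ≠ 0

lemma Np.symm {a b : Pt} (h : Np a b) : Np b a := by
  intro h0; apply h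
  have h00 := congrFun h0 0
  have h01 := congrFun h0 1
  have h02 := congrFun h0 2
  simp [cr] at h00 h01 h02
  ext i; fin_cases i <;> simp [cr] <;> linarith

lemma Np.ne_left {a b : Pt} (h : Np a b) : a ≠ 0 := by
  rintro rfl; apply h; ext i; fin_cases i <;> simp [cr]

lemma Np.ne_right {a b : Pt} (h : Np a b) : b ≠ 0 := h.symm.ne_left

def ln (a b : Pt) : R3 := lin (cr a b)

lemma ln_hom (a b : Pt) : (ln a b).IsHomogeneous 1 := lin_hom _
lemma ln_ne {a b : Pt} (h : Np a b) : ln a b ≠ 0 := lin_ne h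
lemma eval_ln (a b c : Pt) : eval c (ln a b) = dt a b c := by
  simp [ln, eval_lin, cr, dt]
lemma ln_left (a b : Pt) : eval a (ln a b) = 0 := by rw [eval_ln, dt]; ring
lemma ln_right (a b : Pt) : eval b (ln a b) = 0 := by rw [eval_ln, dt]; ring

lemma dd_ln (a v x y : Pt) : dd a v (ln x y) = dt x y v := by
  rw [ln, dd_lin, ← ln, eval_ln]

/-- If ¬Np a b and a ≠ 0, b is a multiple of a -/
lemma smul_of_not_np {a b : Pt} (ha : a ≠ 0) (h : ¬ Np a b) : ∃ c : ℝ, b = c • a := by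
  simp only [Np, not_not] at h
  have h0 := congrFun h 0
  have h1 := congrFun h 1
  have h2 := congrFun h 2
  simp [cr] at h0 h1 h2
  have : a 0 ≠ 0 ∨ a 1 ≠ 0 ∨ a 2 ≠ 0 := by
    by_contra hc; push Not at hc
    apply ha; ext i; fin_cases i <;> simp [hc]
  rcases this with h | h | h
  · refine ⟨b 0 / a 0, ?_⟩
    ext i; fin_cases i <;> simp <;> field_simp <;> linarith
  · refine ⟨b 1 / a 1, ?_⟩
    ext i; fin_cases i <;> simp <;> field_simp <;> linarith
  · refine ⟨b 2 / a 2, ?_⟩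
    ext i; fin_cases i <;> simp <;> field_simp <;> linarith

/-- linear form through two nonproportional points is a multiple of `ln` -/
lemma lin_eq_ln {a b : Pt} (h : Np a b) {l : R3} (hl : l.IsHomogeneous 1)
    (h1 : eval a l = 0) (h2 : eval b l = 0) : ∃ k : ℝ, l = C k * ln a b := by
  obtain ⟨n, rfl⟩ := lin_surj hl
  rw [eval_lin] at h1 h2
  have : ¬ Np (cr a b) n := by
    simp only [Np, not_not]
    ext i; fin_cases i <;> simp [cr]
    · linear_combination b 0 * h1 - a 0 * h2
    · linear_combination b 1 * h1 - a 1 * h2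
    · linear_combination b 2 * h1 - a 2 * h2
  obtain ⟨c, rfl⟩ := smul_of_not_np h this
  refine ⟨c, ?_⟩
  simp [ln, lin, Finset.mul_sum, mul_assoc]

/-- For collinear triples -/
lemma dt_zero_ln {w a b c : Pt} (hw : Np w a) (h1 : dt a b w = 0) (h2 : dt a c w = 0) :
    eval b (ln w a) = 0 ∧ eval c (ln w a) = 0 := by
  simp only [eval_ln, dt] at *
  constructor
  · linear_combination h1
  · linear_combination h2

/-- a linear form separating -/
lemma sep_lin {a b : Pt} (h : Np a b) : ∃ l : R3, l.IsHomogeneous 1 ∧ eval a l = 0 ∧ eval b l ≠ 0 := by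
  refine ⟨lin (cr a (cr a b)), lin_hom _, ?_, ?_⟩
  · rw [eval_lin]; simp [cr]; ring
  · intro h0
    rw [eval_lin] at h0
    apply h
    simp [cr] at h0
    have : (a 1 * b 2 - a 2 * b 1)^2 + (a 2 * b 0 - a 0 * b 2)^2 + (a 0 * b 1 - a 1 * b 0)^2 = 0 := by
      linear_combination -h0
    have e0 : a 1 * b 2 - a 2 * b 1 = 0 := by nlinarith [sq_nonneg (a 1 * b 2 - a 2 * b 1), sq_nonneg (a 2 * b 0 - a 0 * b 2), sq_nonneg (a 0 * b 1 - a 1 * b 0)]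
    have e1 : a 2 * b 0 - a 0 * b 2 = 0 := by nlinarith [sq_nonneg (a 1 * b 2 - a 2 * b 1), sq_nonneg (a 2 * b 0 - a 0 * b 2), sq_nonneg (a 0 * b 1 - a 1 * b 0)]
    have e2 : a 0 * b 1 - a 1 * b 0 = 0 := by nlinarith [sq_nonneg (a 1 * b 2 - a 2 * b 1), sq_nonneg (a 2 * b 0 - a 0 * b 2), sq_nonneg (a 0 * b 1 - a 1 * b 0)]
    ext i; fin_cases i <;> simp [cr, e0, e1, e2]

lemma exists_lin_ne {a : Pt} (h : a ≠ 0) : ∃ l : R3, l.IsHomogeneous 1 ∧ eval a l ≠ 0 := by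
  refine ⟨lin a, lin_hom _, ?_⟩
  intro h0; apply h
  rw [eval_lin] at h0
  have e0 : a 0 = 0 := by nlinarith [mul_self_nonneg (a 0), mul_self_nonneg (a 1), mul_self_nonneg (a 2)]
  have e1 : a 1 = 0 := by nlinarith [mul_self_nonneg (a 0), mul_self_nonneg (a 1), mul_self_nonneg (a 2)]
  have e2 : a 2 = 0 := by nlinarith [mul_self_nonneg (a 0), mul_self_nonneg (a 1), mul_self_nonneg (a 2)]
  ext i; fin_cases i <;> simp [e0, e1, e2]

end

section

lemma lin_same {a b x : Pt} (h : Np a b) {l m : R3} (hl : l.IsHomogeneous 1) (hm : m.IsHomogeneous 1)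
    (hl0 : l ≠ 0) (h1 : eval a l = 0) (h2 : eval b l = 0) (h3 : eval a m = 0) (h4 : eval b m = 0)
    (hx : eval x l = 0) : eval x m = 0 := by
  obtain ⟨k, rfl⟩ := lin_eq_ln h hl h1 h2
  obtain ⟨k', rfl⟩ := lin_eq_ln h hm h3 h4
  have : k ≠ 0 := by rintro rfl; simp at hl0
  simp [this] at hx
  simp [hx]

lemma sep4 {a b c d w : Pt} (ha : Np w a) (hb : Np w b) (hc : Np w c) (hd : Np w d)
    (hN : ∀ l : R3, l ≠ 0 → l.IsHomogeneous 1 → eval w l = 0 →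
      ¬ (eval a l = 0 ∧ eval b l = 0 ∧ eval c l = 0) ∧
      ¬ (eval a l = 0 ∧ eval b l = 0 ∧ eval d l = 0) ∧
      ¬ (eval a l = 0 ∧ eval c l = 0 ∧ eval d l = 0) ∧
      ¬ (eval b l = 0 ∧ eval c l = 0 ∧ eval d l = 0)) :
    ∃ q : R3, q.IsHomogeneous 2 ∧ eval a q = 0 ∧ eval b q = 0 ∧ eval c q = 0 ∧ eval d q = 0 ∧
      eval w q ≠ 0 := by
  have key : ∀ a b : Pt, eval b (ln w a) = dt a b w := by
    intro a b; rw [eval_ln, dt, dt]; ring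
  have key2 : ∀ a b : Pt, dt b a w = - dt a b w := by
    intro a b; rw [dt, dt]; ring
  have key3 : ∀ a : Pt, dt a a w = 0 := by
    intro a; rw [dt]; ring
  have Na := hN _ (ln_ne ha) (ln_hom _ _) (ln_left _ _)
  have Nb := hN _ (ln_ne hb) (ln_hom _ _) (ln_left _ _)
  have Nc := hN _ (ln_ne hc) (ln_hom _ _) (ln_left _ _)
  have Nd := hN _ (ln_ne hd) (ln_hom _ _) (ln_left _ _)
  simp only [key, key3, true_and, and_true] at Na Nb Nc Nd
  rw [key2 a b] at Nb
  rw [key2 a c, key2 b c] at Nc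
  rw [key2 a d, key2 b d, key2 c d] at Nd
  simp only [neg_eq_zero] at Na Nb Nc Nd
  by_cases h1 : dt a b w * dt c d w = 0
  · by_cases h2 : dt a c w * dt b d w = 0
    · exfalso
      rw [mul_eq_zero] at h1 h2
      rcases h1 with h1 | h1 <;> rcases h2 with h2 | h2
      · exact Na.1 ⟨h1, h2⟩
      · exact Nb.2.1 ⟨h1, h2⟩
      · exact Nc.2.2.1 ⟨h2, h1⟩
      · exact Nd.2.2.2 ⟨h2, h1⟩
    · refine ⟨ln a c * ln b d, (ln_hom _ _).mul (ln_hom _ _), ?_, ?_, ?_, ?_, ?_⟩ <;>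
        simp [ln_left, ln_right]
      simpa [eval_ln] using h2
  · refine ⟨ln a b * ln c d, (ln_hom _ _).mul (ln_hom _ _), ?_, ?_, ?_, ?_, ?_⟩ <;>
        simp [ln_left, ln_right]
    simpa [eval_ln] using h1

def evs {ι : Type*} (x : ι → Pt) : R3 →ₗ[ℝ] (ι → ℝ) := LinearMap.pi fun i => ev (x i)

lemma evs_apply {ι : Type*} (x : ι → Pt) (f : R3) (i : ι) : evs x f i = eval (x i) f := by
  simp [evs, ev_apply]

lemma conic_unique (x : Fin 5 → Pt) (hnp : ∀ i j, i ≠ j → Np (x i) (x j))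
    (hN : ∀ l : R3, l ≠ 0 → l.IsHomogeneous 1 → ∀ s : Finset (Fin 5),
      (∀ i ∈ s, eval (x i) l = 0) → s.card ≤ 3)
    {c d : R3} (hc : c.IsHomogeneous 2) (hd : d.IsHomogeneous 2) (hc0 : c ≠ 0)
    (hcx : ∀ i, eval (x i) c = 0) (hdx : ∀ i, eval (x i) d = 0) : ∃ k : ℝ, d = C k * c := by
  have f1 : ∀ k : Fin 5, k ≠ k+1 ∧ k ≠ k+2 ∧ k ≠ k+3 ∧ k ≠ k+4 := by decide
  have f2 : ∀ k : Fin 5, ({k, k+1, k+2, k+3} : Finset (Fin 5)).card = 4 ∧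
    ({k, k+1, k+2, k+4} : Finset (Fin 5)).card = 4 ∧ ({k, k+1, k+3, k+4} : Finset (Fin 5)).card = 4 ∧
    ({k, k+2, k+3, k+4} : Finset (Fin 5)).card = 4 := by decide
  have f3 : ∀ k j : Fin 5, j ≠ k → j = k + 1 ∨ j = k + 2 ∨ j = k + 3 ∨ j = k + 4 := by decide
  have hs : Function.Surjective (res 2 (evs x)) := by
    apply surj_of_tri
    intro k
    have hN' : ∀ l : R3, l ≠ 0 → l.IsHomogeneous 1 → ∀ i j m n : Fin 5,
        ({i, j, m, n} : Finset (Fin 5)).card = 4 →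
        ¬ (eval (x i) l = 0 ∧ eval (x j) l = 0 ∧ eval (x m) l = 0 ∧ eval (x n) l = 0) := by
      rintro l hl hl1 i j m n hcard ⟨h1, h2, h3, h4⟩
      have := hN l hl hl1 {i, j, m, n} (by
        intro a ha; simp at ha; rcases ha with rfl | rfl | rfl | rfl <;> assumption)
      omega
    obtain ⟨q, hq, h1, h2, h3, h4, h5⟩ := sep4 (w := x k) (a := x (k+1)) (b := x (k+2)) (c := x (k+3))
      (d := x (k+4)) (hnp _ _ (f1 k).1) (hnp _ _ (f1 k).2.1)
      (hnp _ _ (f1 k).2.2.1) (hnp _ _ (f1 k).2.2.2)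
      (by
        intro l hl hl1 hw
        refine ⟨?_, ?_, ?_, ?_⟩
        · have := hN' l hl hl1 k (k+1) (k+2) (k+3) (f2 k).1
          exact fun h => this ⟨hw, h⟩
        · have := hN' l hl hl1 k (k+1) (k+2) (k+4) (f2 k).2.1
          exact fun h => this ⟨hw, h⟩
        · have := hN' l hl hl1 k (k+1) (k+3) (k+4) (f2 k).2.2.1
          exact fun h => this ⟨hw, h⟩
        · have := hN' l hl hl1 k (k+2) (k+3) (k+4) (f2 k).2.2.2
          exact fun h => this ⟨hw, h⟩)
    refine ⟨⟨q, hq⟩, by simpa [res, evs_apply] using h5, ?_⟩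
    intro j hj
    have : j = k + 1 ∨ j = k + 2 ∨ j = k + 3 ∨ j = k + 4 := f3 k j hj.ne
    simp only [res, LinearMap.comp_apply, Submodule.subtype_apply, evs_apply]
    rcases this with rfl | rfl | rfl | rfl <;> assumption
  have hk := finrank_ker _ hs
  have hk1 : Module.finrank ℝ (LinearMap.ker (res 2 (evs x))) = 1 := by
    have : (2 + 2).choose 2 = 6 := by decide
    omega
  have mem : ∀ e : R3, ∀ he : e.IsHomogeneous 2, (∀ i, eval (x i) e = 0) →
      (⟨e, he⟩ : HH 2) ∈ LinearMap.ker (res 2 (evs x)) := by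
    intro e he h
    rw [LinearMap.mem_ker]
    ext i
    simp [res, evs_apply, h]
  let c' : LinearMap.ker (res 2 (evs x)) := ⟨⟨c, hc⟩, mem c hc hcx⟩
  let d' : LinearMap.ker (res 2 (evs x)) := ⟨⟨d, hd⟩, mem d hd hdx⟩
  obtain ⟨k, hk⟩ := exists_smul_eq_of_finrank_eq_one hk1
    (x := c') (by
      intro h; apply hc0
      exact congrArg (fun z : LinearMap.ker (res 2 (evs x)) => ((z : HH 2) : R3)) h) d'
  refine ⟨k, ?_⟩
  have : k • c = d := congrArg (fun z : LinearMap.ker (res 2 (evs x)) => ((z : HH 2) : R3)) hk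
  rw [← this, smul_eq_C_mul]

structure GP (A : Fin 8 → Pt) : Prop where
  np : ∀ i j, i ≠ j → Np (A i) (A j)
  line : ∀ l : R3, l ≠ 0 → l.IsHomogeneous 1 → ∀ s : Finset (Fin 8),
    (∀ i ∈ s, eval (A i) l = 0) → s.card ≤ 3
  conic : ∀ c : R3, c ≠ 0 → c.IsHomogeneous 2 → ∀ s : Finset (Fin 8),
    (∀ i ∈ s, eval (A i) c = 0) → s.card ≤ 6

lemma exists_vanish (A : Fin 8 → Pt) (n : ℕ) (F : Finset (Fin 8)) (hF : F.card < (n+2).choose n) :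
    ∃ f : R3, f ≠ 0 ∧ f.IsHomogeneous n ∧ ∀ i ∈ F, eval (A i) f = 0 := by
  obtain ⟨f, h0, h1, h2⟩ := exists_form n (evs fun i : F => A i) (by simpa using hF)
  refine ⟨f, h0, h1, fun i hi => ?_⟩
  have := congrFun h2 ⟨i, hi⟩
  simpa [evs_apply] using this

variable {A : Fin 8 → Pt}

lemma conic_unique5 (hA : GP A) (F : Finset (Fin 8)) (hF : F.card = 5)
    {c d : R3} (hc : c.IsHomogeneous 2) (hd : d.IsHomogeneous 2) (hc0 : c ≠ 0)
    (hcx : ∀ i ∈ F, eval (A i) c = 0) (hdx : ∀ i ∈ F, eval (A i) d = 0) : ∃ k : ℝ, d = C k * c := by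
  let g := F.orderEmbOfFin hF
  have hg : ∀ i, g i ∈ F := fun i => Finset.orderEmbOfFin_mem F hF i
  refine conic_unique (fun i => A (g i)) ?_ ?_ hc hd hc0 (fun i => hcx _ (hg i)) (fun i => hdx _ (hg i))
  · intro i j hij
    exact hA.np _ _ (fun h => hij (g.injective h))
  · intro l hl hl1 s hs
    have := hA.line l hl hl1 (s.map g.toEmbedding) (by simpa using hs)
    simpa using this

lemma conic_uniquew (hA : GP A) (F : Finset (Fin 8)) (hF : F.card = 4) (w : Pt)
    (hw : ∀ i ∈ F, Np w (A i))
    (hl3 : ∀ l : R3, l ≠ 0 → l.IsHomogeneous 1 → eval w l = 0 → ∀ s ⊆ F,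
      (∀ i ∈ s, eval (A i) l = 0) → s.card ≤ 2)
    {c d : R3} (hc : c.IsHomogeneous 2) (hd : d.IsHomogeneous 2) (hc0 : c ≠ 0)
    (hcx : ∀ i ∈ F, eval (A i) c = 0) (hdx : ∀ i ∈ F, eval (A i) d = 0)
    (hcw : eval w c = 0) (hdw : eval w d = 0) : ∃ k : ℝ, d = C k * c := by
  let g := F.orderEmbOfFin hF
  have hg : ∀ i, g i ∈ F := fun i => Finset.orderEmbOfFin_mem F hF i
  refine conic_unique (Fin.cons w (fun i => A (g i))) ?_ ?_ hc hd hc0 ?_ ?_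
  · intro i j
    refine Fin.cases ?_ (fun i => ?_) i <;> refine Fin.cases ?_ (fun j => ?_) j
    · simp
    · intro _; simpa using hw _ (hg j)
    · intro _; simpa using (hw _ (hg i)).symm
    · intro hij
      simpa using hA.np _ _ (fun h => hij (by rw [g.injective h]))
  · intro l hl hl1 s hs
    let t : Finset (Fin 4) := Finset.univ.filter fun i => i.succ ∈ s
    have ht : ∀ i ∈ t, eval (A (g i)) l = 0 := by
      intro i hi
      have := hs i.succ (by simpa [t] using hi)
      simpa using this
    have hst : s ⊆ insert 0 (t.map (Fin.succEmb 4)) := by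
      intro i
      refine Fin.cases ?_ (fun i => ?_) i
      · simp
      · intro hi; simp [t, hi]
    by_cases h0 : (0 : Fin 5) ∈ s
    · have := hl3 l hl hl1 (by simpa using hs 0 h0) (t.map g.toEmbedding) (by
        intro i hi; simp at hi; obtain ⟨a, _, rfl⟩ := hi; exact hg a) (by simpa using ht)
      have h2 := (Finset.card_le_card hst).trans (Finset.card_insert_le _ _)
      simp at this h2
      omega
    · have hst : s ⊆ (t.map (Fin.succEmb 4)) := by
        intro i
        refine Fin.cases ?_ (fun i => ?_) i
        · intro h; exact absurd h h0
        · intro hi; simp [t, hi]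
      have := hA.line l hl hl1 (t.map g.toEmbedding) (by simpa using ht)
      have h2 := (Finset.card_le_card hst)
      simp at this h2
      omega
  · intro i; refine Fin.cases ?_ (fun i => ?_) i
    · simpa using hcw
    · simpa using hcx _ (hg i)
  · intro i; refine Fin.cases ?_ (fun i => ?_) i
    · simpa using hdw
    · simpa using hdx _ (hg i)

/-- separating a tangent vector -/
lemma sep_tangent (hA : GP A) (i j : Fin 8) (hij : i ≠ j) (v : Pt) (hv : Np (A i) v) :
    ∃ c : R3, c.IsHomogeneous 3 ∧ (∀ k, k ≠ j → eval (A k) c = 0) ∧ dd (A i) v c ≠ 0 := by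
  by_contra hcon
  push Not at hcon
  have hZ : (Finset.univ.filter fun k => eval (A k) (ln (A i) v) = 0).card ≤ 3 :=
    hA.line _ (ln_ne hv) (ln_hom _ _) _ (by simp)
  have hgood : 2 ≤ (Finset.univ.filter fun k => k ≠ j ∧ eval (A k) (ln (A i) v) ≠ 0).card := by
    have : (Finset.univ : Finset (Fin 8)) ⊆ (Finset.univ.filter fun k => k ≠ j ∧ eval (A k) (ln (A i) v) ≠ 0)
      ∪ ((Finset.univ.filter fun k => eval (A k) (ln (A i) v) = 0) ∪ {j}) := by
      intro k _; simp; tauto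
    have h1 := Finset.card_le_card this
    have h2 := Finset.card_union_le (Finset.univ.filter fun k => k ≠ j ∧ eval (A k) (ln (A i) v) ≠ 0)
       ((Finset.univ.filter fun k => eval (A k) (ln (A i) v) = 0) ∪ {j})
    have h3 := Finset.card_union_le (Finset.univ.filter fun k => eval (A k) (ln (A i) v) = 0) {j}
    simp only [Finset.card_univ, Fintype.card_fin, Finset.card_singleton] at h1 h3
    omega
  have step : ∀ k, k ≠ j → eval (A k) (ln (A i) v) ≠ 0 →
      k ≠ i ∧ ∃ c : R3, c ≠ 0 ∧ c.IsHomogeneous 2 ∧ ∀ m, m ≠ j → m ≠ k → eval (A m) c = 0 := by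
    intro k hkj hk
    have hki : k ≠ i := by rintro rfl; exact hk (ln_left _ _)
    refine ⟨hki, ?_⟩
    obtain ⟨c, hc0, hc, hcv⟩ := exists_vanish A 2 (Finset.univ \ {i, j, k}) (by
      rw [Finset.card_sdiff_of_subset (by simp), Finset.card_eq_three.mpr ⟨i, j, k, hij, hki.symm, hkj.symm, rfl⟩]
      decide)
    have hcv' : ∀ m, m ≠ i → m ≠ j → m ≠ k → eval (A m) c = 0 := by
      intro m h1 h2 h3; exact hcv m (by simp [h1, h2, h3])
    refine ⟨c, hc0, hc, ?_⟩
    intro m hmj hmk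
    by_cases hmi : m = i
    · subst hmi
      have := hcon (ln (A m) (A k) * c) ((ln_hom _ _).mul hc) (by
        intro n hn
        by_cases h1 : n = m
        · subst h1; simp [ln_left]
        · by_cases h2 : n = k
          · subst h2; simp [ln_right]
          · simp [hcv' n h1 hn h2])
      rw [dd_mul, dd_ln, ln_left, zero_mul, add_zero, mul_eq_zero] at this
      rcases this with h | h
      · exfalso; apply hk; rw [eval_ln]; rw [dt] at *; linear_combination -h
      · exact h
    · exact hcv' m hmi hmj hmk
  obtain ⟨a, ha, b, hb, hab⟩ := Finset.one_lt_card.mp hgood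
  simp at ha hb
  obtain ⟨hai, c, hc0, hc, hcv⟩ := step a ha.1 ha.2
  obtain ⟨hbi, d, hd0, hd, hdv⟩ := step b hb.1 hb.2
  obtain ⟨k, rfl⟩ := conic_unique5 hA (Finset.univ \ {a, b, j}) (by
      rw [Finset.card_sdiff_of_subset (by simp), Finset.card_eq_three.mpr ⟨a, b, j, hab, ha.1, hb.1, rfl⟩]
      decide) hc hd hc0 (by
        intro m hm; simp at hm; exact hcv m (by tauto) (by tauto)) (by
        intro m hm; simp at hm; exact hdv m (by tauto) (by tauto))
  have hk : k ≠ 0 := by rintro rfl; simp at hd0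
  have hca : eval (A a) c = 0 := by
    have := hdv a ha.1 hab
    simpa [hk] using this
  have := hA.conic c hc0 hc (Finset.univ.erase j) (by
    intro m hm
    simp at hm
    by_cases h : m = a
    · rw [h]; exact hca
    · exact hcv m hm h)
  simp at this

end

section

lemma sep_core {A : Fin 8 → Pt} (hA : GP A) (j : Fin 8) (w : Pt) (hw : ∀ i, i ≠ j → Np w (A i))
    (x y z t d e f : Fin 8) (hcov : ∀ i, i ≠ j → i = x ∨ i = y ∨ i = z ∨ i = t ∨ i = d ∨ i = e ∨ i = f)
    (hyj : y ≠ j) (hzj : z ≠ j) (hej : e ≠ j) (hfj : f ≠ j) (hdj : d ≠ j)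
    (hyz : y ≠ z) (hef : e ≠ f)
    (l : R3) (hl0 : l ≠ 0) (hl : l.IsHomogeneous 1) (hlw : eval w l = 0)
    (hld : eval (A d) l = 0) (hle : eval (A e) l = 0) (hlf : eval (A f) l = 0)
    (hlx : eval (A x) l ≠ 0) (hly : eval (A y) l ≠ 0) (hlz : eval (A z) l ≠ 0) (hlt : eval (A t) l ≠ 0)
    (hdt : dt (A y) (A z) (A t) ≠ 0) :
    ∃ c : R3, c.IsHomogeneous 3 ∧ (∀ k, k ≠ j → eval (A k) c = 0) ∧ eval w c ≠ 0 := by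
  have hne : ∀ a b, eval (A a) l ≠ 0 → eval (A b) l = 0 → a ≠ b := by
    rintro a b h1 h2 rfl; exact h1 h2
  obtain ⟨c, hc0, hc, hcv⟩ := exists_vanish A 2 {y, z, t, e, f}
    (lt_of_le_of_lt Finset.card_le_five (by decide))
  by_cases hcw : eval w c = 0
  · exfalso
    have hF : ({y, z, e, f} : Finset (Fin 8)).card = 4 := by
      rw [Finset.card_insert_of_notMem, Finset.card_insert_of_notMem, Finset.card_pair hef]
      · simp [hne z e hlz hle, hne z f hlz hlf]
      · simp [hyz, hne y e hly hle, hne y f hly hlf]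
    obtain ⟨k, hk⟩ := conic_uniquew hA {y, z, e, f} hF w (by
        intro i hi; simp at hi; rcases hi with rfl | rfl | rfl | rfl <;> exact hw _ (by assumption))
      (by
        intro m hm0 hm hmw s hs hms
        by_cases h1 : e ∈ s ∨ f ∈ s
        · have hlm : ∀ u, eval u m = 0 → eval u l = 0 := by
            intro u hu
            rcases h1 with h1 | h1
            · exact lin_same (hw e hej) hm hl hm0 hmw (hms _ h1) hlw hle hu
            · exact lin_same (hw f hfj) hm hl hm0 hmw (hms _ h1) hlw hlf hu
          have : s ⊆ {e, f} := by
            intro i hi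
            have h2 := hs hi
            have h3 := hlm _ (hms i hi)
            simp at h2 ⊢
            rcases h2 with rfl | rfl | h2
            · exact absurd h3 hly
            · exact absurd h3 hlz
            · exact h2
          exact (Finset.card_le_card this).trans Finset.card_le_two
        · push Not at h1
          have : s ⊆ {y, z} := by
            intro i hi
            have h2 := hs hi
            simp at h2 ⊢
            rcases h2 with rfl | rfl | rfl | rfl
            · simp
            · simp
            · exact absurd hi h1.1
            · exact absurd hi h1.2
          exact (Finset.card_le_card this).trans Finset.card_le_two)
      hc (d := l * ln (A y) (A z)) (hl.mul (ln_hom _ _)) hc0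
      (by
        intro i hi; apply hcv; simp at hi ⊢; tauto)
      (by
        intro i hi; simp at hi; rcases hi with rfl | rfl | rfl | rfl <;>
          simp [ln_left, ln_right, hle, hlf])
      hcw (by simp [hlw])
    have := congrArg (eval (A t)) hk
    rw [map_mul, map_mul, hcv t (by simp), mul_zero, eval_ln] at this
    exact mul_ne_zero hlt hdt this
  · refine ⟨ln (A x) (A d) * c, (ln_hom _ _).mul hc, ?_, ?_⟩
    · intro i hi
      have : i = x ∨ i = d ∨ i ∈ ({y, z, t, e, f} : Finset (Fin 8)) := by
        have := hcov i hi
        simp; tauto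
      rcases this with rfl | rfl | h
      · simp [ln_left]
      · simp [ln_right]
      · simp [hcv i h]
    · rw [map_mul]
      refine mul_ne_zero ?_ hcw
      intro h
      have hxd := hA.np x d (hne _ _ hlx hld)
      exact hlx (lin_same (hw d hdj) (ln_hom _ _) hl (ln_ne hxd) h (ln_right _ _) hlw hld (ln_left _ _))

lemma sep_point {A : Fin 8 → Pt} (hA : GP A) (j : Fin 8) (w : Pt) (hw : ∀ i, i ≠ j → Np w (A i)) :
    ∃ c : R3, c.IsHomogeneous 3 ∧ (∀ k, k ≠ j → eval (A k) c = 0) ∧ eval w c ≠ 0 := by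
  by_cases H : ∀ l : R3, l ≠ 0 → l.IsHomogeneous 1 → eval w l = 0 → ∀ s : Finset (Fin 8),
    (∀ i ∈ s, i ≠ j ∧ eval (A i) l = 0) → s.card ≤ 2
  · by_contra hcon
    push Not at hcon
    have step : ∀ i k, i ≠ j → k ≠ j → i ≠ k → dt (A i) (A k) w ≠ 0 →
        ∃ c : R3, c ≠ 0 ∧ c.IsHomogeneous 2 ∧ (∀ m, m ≠ j → m ≠ i → m ≠ k → eval (A m) c = 0) ∧
          eval w c = 0 := by
      intro i k hij hkj hik hg
      obtain ⟨c, hc0, hc, hcv⟩ := exists_vanish A 2 (Finset.univ \ {i, k, j}) (by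
        rw [Finset.card_sdiff_of_subset (by simp), Finset.card_eq_three.mpr ⟨i, k, j, hik, hij, hkj, rfl⟩]
        decide)
      have hcv' : ∀ m, m ≠ j → m ≠ i → m ≠ k → eval (A m) c = 0 := by
        intro m h1 h2 h3; exact hcv m (by simp [h1, h2, h3])
      refine ⟨c, hc0, hc, hcv', ?_⟩
      have := hcon (ln (A i) (A k) * c) ((ln_hom _ _).mul hc) (by
        intro n hn
        by_cases h1 : n = i
        · subst h1; simp [ln_left]
        · by_cases h2 : n = k
          · subst h2; simp [ln_right]
          · simp [hcv' n hn h1 h2])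
      rw [map_mul, eval_ln, mul_eq_zero] at this
      exact this.resolve_left hg
    have sub : ∀ i k m, i ≠ j → k ≠ j → m ≠ j → i ≠ k → i ≠ m → k ≠ m → dt (A i) (A m) w ≠ 0 →
        ∀ c : R3, c ≠ 0 → c.IsHomogeneous 2 → (∀ m, m ≠ j → m ≠ i → m ≠ k → eval (A m) c = 0) →
          eval w c = 0 → eval (A k) c = 0 := by
      intro i k m hi hk hm hik him hkm hg c hc0 hc hcv hcw
      obtain ⟨d, hd0, hd, hdv, hdw⟩ := step i m hi hm him hg
      obtain ⟨r, rfl⟩ := conic_uniquew hA (Finset.univ \ {j, i, k, m}) (by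
          rw [Finset.card_sdiff_of_subset (by simp), Finset.card_insert_of_notMem (by
            simp [hi.symm, hk.symm, hm.symm]),
            Finset.card_eq_three.mpr ⟨i, k, m, hik, him, hkm, rfl⟩]
          decide) w (by
          intro n hn; simp at hn; exact hw n hn.1) (by
          intro l hl0 hl hlw s hs hsl
          refine H l hl0 hl hlw s fun n hn => ⟨?_, hsl n hn⟩
          have := hs hn
          simp at this; exact this.1) hc hd hc0 (by
          intro n hn; simp at hn; exact hcv n hn.1 hn.2.1 hn.2.2.1) (by
          intro n hn; simp at hn; exact hdv n hn.1 hn.2.1 hn.2.2.2) hcw hdw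
      have hr : r ≠ 0 := by rintro rfl; simp at hd0
      have := hdv k hk hik.symm hkm
      simpa [hr] using this
    have hg : ∀ i u, i ≠ j → ∃ k, k ≠ j ∧ k ≠ i ∧ k ≠ u ∧ dt (A i) (A k) w ≠ 0 := by
      intro i u hi
      by_contra hb
      push Not at hb
      have hc : 1 < (Finset.univ \ {i, j, u} : Finset (Fin 8)).card := by
        rw [Finset.card_sdiff_of_subset (by simp)]
        have := Finset.card_le_three (a := i) (b := j) (c := u)
        simp only [Finset.card_univ, Fintype.card_fin]
        omega
      obtain ⟨a, ha, b, hb', hab⟩ := Finset.one_lt_card.mp hc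
      simp at ha hb'
      have h1 := hb a ha.2.1 ha.1 ha.2.2
      have h2 := hb b hb'.2.1 hb'.1 hb'.2.2
      obtain ⟨h3, h4⟩ := dt_zero_ln (hw i hi) h1 h2
      have := H _ (ln_ne (hw i hi)) (ln_hom _ _) (ln_left _ _) {i, a, b} (by
        intro n hn; simp at hn
        rcases hn with rfl | rfl | rfl
        · exact ⟨hi, ln_right _ _⟩
        · exact ⟨ha.2.1, h3⟩
        · exact ⟨hb'.2.1, h4⟩)
      rw [Finset.card_eq_three.mpr ⟨i, a, b, Ne.symm ha.1, Ne.symm hb'.1, hab, rfl⟩] at this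
      omega
    obtain ⟨i, hi⟩ := exists_ne j
    obtain ⟨k, hk, hki, -, hgik⟩ := hg i i hi
    obtain ⟨m, hm, hmi, hmk, hgim⟩ := hg i k hi
    obtain ⟨n, hn, hnk, hni, hgkn⟩ := hg k i hk
    obtain ⟨c, hc0, hc, hcv, hcw⟩ := step i k hi hk hki.symm hgik
    have c1 := sub i k m hi hk hm hki.symm hmi.symm hmk.symm hgim c hc0 hc hcv hcw
    have c2 := sub k i n hk hi hn hki hnk.symm hni.symm hgkn c hc0 hc
      (fun m h1 h2 h3 => hcv m h1 h3 h2) hcw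
    have := hA.conic c hc0 hc (Finset.univ.erase j) (by
      intro m hm
      simp at hm
      by_cases h : m = k
      · rw [h]; exact c1
      by_cases h' : m = i
      · rw [h']; exact c2
      exact hcv m hm h' h)
    simp at this
  · push Not at H
    obtain ⟨l, hl0, hl, hlw, s, hs, hs3⟩ := H
    have hsle := hA.line l hl0 hl s (fun i hi => (hs i hi).2)
    have hcard : s.card = 3 := by omega
    have hout : ∀ i, i ∉ s → eval (A i) l ≠ 0 := by
      intro i hi h
      have := hA.line l hl0 hl (insert i s) (by
        intro k hk; simp at hk; rcases hk with rfl | hk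
        · exact h
        · exact (hs k hk).2)
      rw [Finset.card_insert_of_notMem hi] at this
      omega
    have hjs : j ∉ s := fun h => (hs j h).1 rfl
    have hcomp : ((insert j s)ᶜ).card = 4 := by
      rw [Finset.card_compl, Finset.card_insert_of_notMem hjs, hcard]; simp
    obtain ⟨a, ha⟩ : ((insert j s)ᶜ).Nonempty := by
      rw [← Finset.card_pos]; omega
    have hcomp3 : (((insert j s)ᶜ).erase a).card = 3 := by
      rw [Finset.card_erase_of_mem ha, hcomp]
    obtain ⟨b, c, g, hbc, hbg, hcg, hE⟩ := Finset.card_eq_three.mp hcomp3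
    obtain ⟨d, e, f, hde, hdf, hef, rfl⟩ := Finset.card_eq_three.mp hcard
    have hb : b ∈ (Finset.erase (insert j ({d, e, f} : Finset (Fin 8)))ᶜ a) := by rw [hE]; simp
    have hc : c ∈ (Finset.erase (insert j ({d, e, f} : Finset (Fin 8)))ᶜ a) := by rw [hE]; simp
    have hg : g ∈ (Finset.erase (insert j ({d, e, f} : Finset (Fin 8)))ᶜ a) := by rw [hE]; simp
    have hmem : ∀ i, i ∈ (Finset.erase (insert j ({d, e, f} : Finset (Fin 8)))ᶜ a) → i ≠ a ∧ i ≠ j ∧ eval (A i) l ≠ 0 := by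
      intro i hi
      rw [Finset.mem_erase, Finset.mem_compl, Finset.mem_insert, not_or] at hi
      exact ⟨hi.1, hi.2.1, hout i hi.2.2⟩
    have haj : a ≠ j ∧ eval (A a) l ≠ 0 := by
      rw [Finset.mem_compl, Finset.mem_insert, not_or] at ha
      exact ⟨ha.1, hout a ha.2⟩
    obtain ⟨hba, hbj, hlb⟩ := hmem b hb
    obtain ⟨hca, hcj, hlc⟩ := hmem c hc
    obtain ⟨hga, hgj, hlg⟩ := hmem g hg
    have hcov : ∀ i, i ≠ j → i = a ∨ i = b ∨ i = c ∨ i = g ∨ i = d ∨ i = e ∨ i = f := by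
      intro i hi
      by_cases h1 : i = a
      · exact Or.inl h1
      by_cases h2 : i ∈ ({d, e, f} : Finset (Fin 8))
      · simp at h2; exact Or.inr (Or.inr (Or.inr (Or.inr h2)))
      · have : i ∈ (Finset.erase (insert j ({d, e, f} : Finset (Fin 8)))ᶜ a) := by
          rw [Finset.mem_erase, Finset.mem_compl, Finset.mem_insert, not_or]
          exact ⟨h1, hi, h2⟩
        rw [hE] at this
        simp at this
        rcases this with h | h | h <;> simp [h]
    obtain ⟨hdj, hld⟩ := hs d (by simp)
    obtain ⟨hej, hle⟩ := hs e (by simp)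
    obtain ⟨hfj, hlf⟩ := hs f (by simp)
    by_cases h1 : dt (A b) (A c) (A g) = 0
    · have h2 : dt (A b) (A c) (A a) ≠ 0 := by
        intro h2
        have := hA.line _ (ln_ne (hA.np b c hbc)) (ln_hom _ _) {a, b, c, g} (by
          intro n hn; simp at hn
          rcases hn with rfl | rfl | rfl | rfl
          · rw [eval_ln]; exact h2
          · exact ln_left _ _
          · exact ln_right _ _
          · rw [eval_ln]; exact h1)
        rw [Finset.card_insert_of_notMem (by simp [hba.symm, hca.symm, hga.symm]),
          Finset.card_eq_three.mpr ⟨b, c, g, hbc, hbg, hcg, rfl⟩] at this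
        omega
      exact sep_core hA j w hw g b c a d e f (fun i hi => by rcases hcov i hi with h | h | h | h | h | h | h <;> simp [h])
        hbj hcj hej hfj hdj hbc hef l hl0 hl hlw hld hle hlf hlg hlb hlc haj.2 h2
    · exact sep_core hA j w hw a b c g d e f hcov
        hbj hcj hej hfj hdj hbc hef l hl0 hl hlw hld hle hlf haj.2 hlb hlc hlg h1

end

section

lemma top_mul {g h : R3} {m n : ℕ} (hg : g.totalDegree ≤ m) (hh : h.totalDegree ≤ n) :
    homogeneousComponent (m + n) (g * h) = homogeneousComponent m g * homogeneousComponent n h := by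
  have zero : ∀ (f : R3) (k : ℕ), f.totalDegree ≤ k → ∀ d : Fin 3 →₀ ℕ, k < d.degree → coeff d f = 0 := by
    intro f k hf d hd
    by_contra hne
    have := le_totalDegree (mem_support_iff.mpr hne)
    rw [Finsupp.degree_eq_sum] at hd
    rw [Finsupp.sum_fintype _ _ (by simp)] at this
    omega
  ext d
  rw [coeff_homogeneousComponent]
  split_ifs with hd
  · rw [coeff_mul, coeff_mul]
    refine Finset.sum_congr rfl fun x hx => ?_
    rw [Finset.HasAntidiagonal.mem_antidiagonal] at hx
    have hdeg : x.1.degree + x.2.degree = m + n := by rw [← map_add, hx, hd]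
    rw [coeff_homogeneousComponent, coeff_homogeneousComponent]
    by_cases h1 : x.1.degree = m
    · have h2 : x.2.degree = n := by omega
      rw [if_pos h1, if_pos h2]
    · rw [if_neg h1, zero_mul]
      rcases lt_or_gt_of_ne h1 with h' | h'
      · rw [zero h n hh x.2 (by omega), mul_zero]
      · rw [zero g m hg x.1 h', zero_mul]
  · exact (((homogeneousComponent_isHomogeneous m g).mul
      (homogeneousComponent_isHomogeneous n h)).coeff_eq_zero hd).symm

structure Pencil (A : Fin 8 → Pt) (p q : R3) : Prop where
  hp : p.IsHomogeneous 3
  hq : q.IsHomogeneous 3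
  vp : ∀ i, eval (A i) p = 0
  vq : ∀ i, eval (A i) q = 0
  span : ∀ c : R3, c.IsHomogeneous 3 → (∀ i, eval (A i) c = 0) → ∃ α β : ℝ, c = C α * p + C β * q
  ind : ∀ α β : ℝ, C α * p + C β * q = 0 → α = 0 ∧ β = 0

variable {A : Fin 8 → Pt} {p q : R3}

lemma GP.dual (hA : GP A) (i : Fin 8) : ∃ c : R3, c.IsHomogeneous 3 ∧
    (∀ k, k ≠ i → eval (A k) c = 0) ∧ eval (A i) c ≠ 0 :=
  sep_point hA i (A i) fun k hk => hA.np i k hk.symm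

lemma basis_two {W : Type*} [AddCommGroup W] [Module ℝ W] (h : Module.finrank ℝ W = 2) :
    ∃ x y : W, (∀ z, ∃ α β : ℝ, z = α • x + β • y) ∧ (∀ α β : ℝ, α • x + β • y = 0 → α = 0 ∧ β = 0) := by
  haveI : Module.Finite ℝ W := Module.finite_of_finrank_pos (by omega)
  let b := Module.finBasisOfFinrankEq ℝ _ h
  refine ⟨b 0, b 1, fun z => ?_, fun α β h0 => ?_⟩
  · have h1 := b.sum_repr z
    rw [Fin.sum_univ_two] at h1
    exact ⟨_, _, h1.symm⟩
  · exact LinearIndependent.pair_iff.mp (by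
      have := b.linearIndependent
      rwa [show (b : Fin 2 → _) = ![b 0, b 1] by ext i; fin_cases i <;> rfl] at this) α β h0

lemma exists_pencil (hA : GP A) : ∃ p q, Pencil A p q := by
  have hs : Function.Surjective (res 3 (evs A)) := by
    apply surj_of_tri
    intro k
    obtain ⟨c, hc, h1, h2⟩ := hA.dual k
    refine ⟨⟨c, hc⟩, by simpa [res, evs_apply] using h2, fun j hj => ?_⟩
    simpa [res, evs_apply] using h1 j hj.ne
  have hk := finrank_ker _ hs
  have hk2 : Module.finrank ℝ (LinearMap.ker (res 3 (evs A))) = 2 := by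
    have : (3 + 2).choose 3 = 10 := by decide
    omega
  obtain ⟨x, y, hsp, hin⟩ := basis_two (W := LinearMap.ker (res 3 (evs A))) hk2
  let cc : LinearMap.ker (res 3 (evs A)) →ₗ[ℝ] R3 := (HH 3).subtype ∘ₗ (Submodule.subtype _)
  have hcc : Function.Injective cc := by
    intro x y h; exact Subtype.ext (Subtype.ext h)
  have hv : ∀ x : LinearMap.ker (res 3 (evs A)), ∀ i, eval (A i) (cc x) = 0 := by
    intro x i
    have := congrFun (LinearMap.mem_ker.mp x.2) i
    have h2 : eval (A i) (x.1 : R3) = 0 := by simpa [res, evs_apply] using this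
    exact h2
  refine ⟨cc x, cc y, x.1.2, y.1.2, hv _, hv _, ?_, ?_⟩
  · intro c hc h
    let c' : LinearMap.ker (res 3 (evs A)) := ⟨⟨c, hc⟩, by
      rw [LinearMap.mem_ker]; ext i; simpa [res, evs_apply] using h i⟩
    obtain ⟨α, β, h1⟩ := hsp c'
    have h2 := congrArg cc h1
    rw [map_add, map_smul, map_smul, smul_eq_C_mul, smul_eq_C_mul] at h2
    exact ⟨_, _, h2⟩
  · intro α β h
    apply hin
    apply hcc
    rw [map_zero, map_add, map_smul, map_smul, smul_eq_C_mul, smul_eq_C_mul, h]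

lemma hom_zero_C {f : R3} (h : f.IsHomogeneous 0) : ∃ r : ℝ, f = C r :=
  ⟨_, totalDegree_eq_zero_iff_eq_C.mp (Nat.le_zero.mp h.totalDegree_le)⟩

lemma Pencil.p_ne (hP : Pencil A p q) : p ≠ 0 := by
  rintro rfl
  have := (hP.ind 1 0 (by simp)).1
  norm_num at this

lemma Pencil.q_ne (hP : Pencil A p q) : q ≠ 0 := by
  rintro rfl
  have := (hP.ind 0 1 (by simp)).2
  norm_num at this

lemma Pencil.no_prop (hP : Pencil A p q) {k : ℝ} (h : q = C k * p) : False := by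
  have := (hP.ind k (-1) (by rw [h]; simp)).2
  norm_num at this

lemma Pencil.no_factor (hA : GP A) (hP : Pencil A p q) {g p1 q1 : R3} {m n : ℕ} (hmn : m + n = 3)
    (hm : m ≠ 0) (hg : g.IsHomogeneous m) (hp1 : p1.IsHomogeneous n) (hq1 : q1.IsHomogeneous n)
    (hp : p = g * p1) (hq : q = g * q1) : False := by
  have hg0 : g ≠ 0 := by rintro rfl; exact hP.p_ne (by simpa using hp)
  have hp0 : p1 ≠ 0 := by rintro rfl; exact hP.p_ne (by simpa using hp)
  have fin : ∀ k : ℝ, q1 = C k * p1 → False := by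
    intro k hk
    apply hP.no_prop (k := k)
    rw [hq, hk, hp]; ring
  have vp1 : ∀ i, eval (A i) g ≠ 0 → eval (A i) p1 = 0 := by
    intro i hi
    have := hP.vp i
    rw [hp, map_mul, mul_eq_zero] at this
    exact this.resolve_left hi
  have vq1 : ∀ i, eval (A i) g ≠ 0 → eval (A i) q1 = 0 := by
    intro i hi
    have := hP.vq i
    rw [hq, map_mul, mul_eq_zero] at this
    exact this.resolve_left hi
  have hcard : (Finset.univ.filter fun i => eval (A i) g = 0).card +
      (Finset.univ.filter fun i => ¬ eval (A i) g = 0).card = 8 := by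
    rw [Finset.card_filter_add_card_filter_not]; simp
  obtain rfl | rfl | rfl : m = 1 ∨ m = 2 ∨ m = 3 := by omega
  · obtain rfl : n = 2 := by omega
    have h1 := hA.line g hg0 hg (Finset.univ.filter fun i => eval (A i) g = 0) (by simp)
    obtain ⟨F, hF, hF5⟩ := Finset.exists_subset_card_eq (n := 5)
      (s := Finset.univ.filter fun i => ¬ eval (A i) g = 0) (by omega)
    have hF' : ∀ i ∈ F, eval (A i) g ≠ 0 := by
      intro i hi; simpa using hF hi
    obtain ⟨k, hk⟩ := conic_unique5 hA F hF5 hp1 hq1 hp0 (fun i hi => vp1 i (hF' i hi))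
      (fun i hi => vq1 i (hF' i hi))
    exact fin k hk
  · obtain rfl : n = 1 := by omega
    have h1 := hA.conic g hg0 hg (Finset.univ.filter fun i => eval (A i) g = 0) (by simp)
    obtain ⟨a, ha, b, hb, hab⟩ := Finset.one_lt_card.mp
      (show 1 < (Finset.univ.filter fun i => ¬ eval (A i) g = 0).card by omega)
    simp at ha hb
    obtain ⟨r, hr⟩ := lin_eq_ln (hA.np a b hab) hp1 (vp1 a ha) (vp1 b hb)
    obtain ⟨s, hs⟩ := lin_eq_ln (hA.np a b hab) hq1 (vq1 a ha) (vq1 b hb)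
    have hr0 : r ≠ 0 := by rintro rfl; simp at hr; exact hp0 hr
    apply fin (s / r)
    rw [hs, hr, ← mul_assoc, ← C_mul, div_mul_cancel₀ _ hr0]
  · obtain rfl : n = 0 := by omega
    obtain ⟨r, hr⟩ := hom_zero_C hp1
    obtain ⟨s, hs⟩ := hom_zero_C hq1
    have hr0 : r ≠ 0 := by rintro rfl; simp at hr; exact hp0 hr
    apply fin (s / r)
    rw [hs, hr, ← C_mul, div_mul_cancel₀ _ hr0]

lemma Pencil.relPrime (hA : GP A) (hP : Pencil A p q) : IsRelPrime p q := by
  rintro g ⟨p1, hp⟩ ⟨q1, hq⟩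
  have hg0 : g ≠ 0 := by rintro rfl; exact hP.p_ne (by simpa using hp)
  have hp0 : p1 ≠ 0 := by rintro rfl; exact hP.p_ne (by simpa using hp)
  have hq0 : q1 ≠ 0 := by rintro rfl; exact hP.q_ne (by simpa using hq)
  have e1 : g.totalDegree + p1.totalDegree = 3 := by
    rw [← totalDegree_mul_of_isDomain hg0 hp0, ← hp]
    exact hP.hp.totalDegree hP.p_ne
  have e2 : g.totalDegree + q1.totalDegree = 3 := by
    rw [← totalDegree_mul_of_isDomain hg0 hq0, ← hq]
    exact hP.hq.totalDegree hP.q_ne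
  by_cases hm : g.totalDegree = 0
  · rw [totalDegree_eq_zero_iff_eq_C] at hm
    rw [hm]
    have : coeff 0 g ≠ 0 := by intro h; rw [h] at hm; simp at hm; exact hg0 hm
    exact (isUnit_iff_ne_zero.mpr this).map C
  · exfalso
    refine hP.no_factor hA e1 hm (homogeneousComponent_isHomogeneous _ g)
      (homogeneousComponent_isHomogeneous _ p1) (homogeneousComponent_isHomogeneous p1.totalDegree q1) ?_ ?_
    · rw [← top_mul le_rfl le_rfl, ← hp, e1, homogeneousComponent_eq_self hP.hp]
    · rw [← top_mul le_rfl (by omega), ← hq, e1, homogeneousComponent_eq_self hP.hq]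

lemma Pencil.syz (hA : GP A) (hP : Pencil A p q) {a b : R3} (ha : a.IsHomogeneous 3)
    (hb : b.IsHomogeneous 3) (h : a * p + b * q = 0) : ∃ r : ℝ, a = C r * q ∧ b = C (-r) * p := by
  have hd : p ∣ b * q := ⟨-a, by linear_combination h⟩
  obtain ⟨r, hr⟩ := (hP.relPrime hA).dvd_of_dvd_mul_right hd
  have hr' : ∃ s : ℝ, r = C s := by
    by_cases hr0 : r = 0
    · exact ⟨0, by simp [hr0]⟩
    · have hb0 : b ≠ 0 := by rw [hr]; exact mul_ne_zero hP.p_ne hr0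
      have h1 := totalDegree_mul_of_isDomain hP.p_ne hr0
      rw [← hr, hb.totalDegree hb0, hP.hp.totalDegree hP.p_ne] at h1
      exact ⟨_, totalDegree_eq_zero_iff_eq_C.mp (by omega)⟩
  obtain ⟨s, rfl⟩ := hr'
  refine ⟨-s, ?_, by rw [hr, neg_neg, mul_comm]⟩
  have : p * (a + C s * q) = 0 := by rw [hr] at h; linear_combination h
  have := (mul_eq_zero.mp this).resolve_left hP.p_ne
  rw [C_neg]; linear_combination this

end

section

lemma dim_abs {V W : Type*} [AddCommGroup V] [Module ℝ V] [AddCommGroup W] [Module ℝ W]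
    [Module.Finite ℝ V] [Module.Finite ℝ W] (M : (V × V) →ₗ[ℝ] W) (S : Submodule ℝ W)
    (hS : LinearMap.range M ≤ S) (x : V × V) (hx : LinearMap.ker M ≤ Submodule.span ℝ {x}) :
    2 * Module.finrank ℝ V ≤ Module.finrank ℝ S + 1 := by
  have h1 := M.finrank_range_add_finrank_ker
  rw [Module.finrank_prod] at h1
  have h2 := Submodule.finrank_mono hS
  have h3 := Submodule.finrank_mono hx
  have h4 : Module.finrank ℝ (Submodule.span ℝ {x}) ≤ 1 := by
    simpa using finrank_span_le_card (R := ℝ) ({x} : Set (V × V))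
  omega

def mulH {f : R3} {n : ℕ} (hf : f.IsHomogeneous n) (m : ℕ) : HH m →ₗ[ℝ] HH (m + n) where
  toFun a := ⟨a.1 * f, IsHomogeneous.mul a.2 hf⟩
  map_add' a b := Subtype.ext (by simp [add_mul])
  map_smul' c a := Subtype.ext (by simp)

def phi10 (A : Fin 8 → Pt) (ψ₁ ψ₂ : R3 →ₗ[ℝ] ℝ) : R3 →ₗ[ℝ] (Fin 10 → ℝ) :=
  LinearMap.pi fun i => if h : (i : ℕ) < 8 then ev (A ⟨i, h⟩) else if (i : ℕ) = 8 then ψ₁ else ψ₂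

variable {A : Fin 8 → Pt} {p q : R3}

lemma bez (hA : GP A) (hP : Pencil A p q) (ψ₁ ψ₂ : R3 →ₗ[ℝ] ℝ)
    (h1p : ∀ a : R3, ψ₁ (a * p) = 0) (h1q : ∀ a : R3, ψ₁ (a * q) = 0)
    (h2p : ∀ a : R3, ψ₂ (a * p) = 0) (h2q : ∀ a : R3, ψ₂ (a * q) = 0)
    (s₁ s₂ : R3) (hs₁ : s₁.IsHomogeneous 6) (hs₂ : s₂.IsHomogeneous 6)
    (v1 : ∀ i, eval (A i) s₁ = 0) (v2 : ∀ i, eval (A i) s₂ = 0)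
    (n1 : ψ₁ s₁ ≠ 0) (z2 : ψ₁ s₂ = 0) (n2 : ψ₂ s₂ ≠ 0) : False := by
  have app : ∀ (f : R3) (hf : f.IsHomogeneous 6) (i : Fin 10),
      res 6 (phi10 A ψ₁ ψ₂) ⟨f, hf⟩ i =
      if h : (i : ℕ) < 8 then eval (A ⟨i, h⟩) f else if (i : ℕ) = 8 then ψ₁ f else ψ₂ f := by
    intro f hf i
    simp only [res, phi10, LinearMap.comp_apply, Submodule.subtype_apply, LinearMap.pi_apply]
    split_ifs
    · exact ev_apply _ _
    · rfl
    · rfl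
  have hs : Function.Surjective (res 6 (phi10 A ψ₁ ψ₂)) := by
    apply surj_of_tri
    intro k
    by_cases hk : (k : ℕ) < 8
    · obtain ⟨c, hc, hc1, hc2⟩ := hA.dual ⟨k, hk⟩
      obtain ⟨l, hl, hl1⟩ := exists_lin_ne (a := A ⟨k, hk⟩) (by
        obtain ⟨j, hj⟩ := exists_ne (⟨k, hk⟩ : Fin 8)
        exact (hA.np _ j hj.symm).ne_left)
      refine ⟨⟨c * (l * l * l), hc.mul ((hl.mul hl).mul hl)⟩, ?_, ?_⟩
      · rw [app, dif_pos hk]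
        simp [hc2, hl1]
      · intro j hj
        have hj8 : (j : ℕ) < 8 := by have : (j : ℕ) < k := hj; omega
        rw [app, dif_pos hj8]
        simp [hc1 ⟨j, hj8⟩ (by intro h; have := congrArg Fin.val h; simp at this
                               have h2 : (j : ℕ) < k := hj; omega)]
    · by_cases hk8 : (k : ℕ) = 8
      · refine ⟨⟨s₁, hs₁⟩, ?_, ?_⟩
        · rw [app, dif_neg hk, if_pos hk8]; exact n1
        · intro j hj
          have hj8 : (j : ℕ) < 8 := by have : (j : ℕ) < k := hj; omega
          rw [app, dif_pos hj8]; exact v1 _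
      · refine ⟨⟨s₂, hs₂⟩, ?_, ?_⟩
        · rw [app, dif_neg hk, if_neg hk8]; exact n2
        · intro j hj
          rw [app]
          split_ifs with h1 h2
          · exact v2 _
          · exact z2
          · have : (j : ℕ) < k := hj
            have := k.2; omega
  have hk := finrank_ker _ hs
  have hM := dim_abs (V := HH 3) (W := HH 6) ((mulH hP.hp 3).coprod (mulH hP.hq 3))
    (LinearMap.ker (res 6 (phi10 A ψ₁ ψ₂))) (by
      rintro _ ⟨⟨a, b⟩, rfl⟩
      rw [LinearMap.mem_ker]
      ext i
      have : ((mulH hP.hp 3).coprod (mulH hP.hq 3)) (a, b)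
        = ⟨a.1 * p + b.1 * q, (IsHomogeneous.mul a.2 hP.hp).add (IsHomogeneous.mul b.2 hP.hq)⟩ := by
        apply Subtype.ext; simp [mulH]
      rw [this, app]
      split_ifs
      · simp [hP.vp, hP.vq]
      · simp [h1p, h1q]
      · simp [h2p, h2q])
    (⟨q, hP.hq⟩, ⟨-p, hP.hp.neg⟩) (by
      rintro ⟨a, b⟩ hab
      rw [LinearMap.mem_ker] at hab
      have h0 : a.1 * p + b.1 * q = 0 := congrArg Subtype.val hab
      obtain ⟨r, hr1, hr2⟩ := hP.syz hA a.2 b.2 h0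
      rw [Submodule.mem_span_singleton]
      refine ⟨r, Prod.ext (Subtype.ext ?_) (Subtype.ext ?_)⟩
      · simp [hr1, smul_eq_C_mul]
      · simp [hr2, smul_eq_C_mul])
  have e3 := finrank_HH 3
  have e6 : (6 + 2).choose 6 = 28 := by decide
  have e5 : (3 + 2).choose 3 = 10 := by decide
  rw [e3] at hM
  omega

lemma GP.ne (hA : GP A) (i : Fin 8) : A i ≠ 0 := by
  obtain ⟨j, hj⟩ := exists_ne i
  exact (hA.np i j hj.symm).ne_left

/-- quintic through all points, nonzero at `w` -/
lemma quint_pt (hA : GP A) {w : Pt} (hw : ∀ i, Np w (A i)) :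
    ∃ r : R3, r.IsHomogeneous 5 ∧ (∀ i, eval (A i) r = 0) ∧ eval w r ≠ 0 := by
  obtain ⟨c, hc, hc1, hc2⟩ := sep_point hA 0 w (fun i _ => hw i)
  obtain ⟨m, hm, hm1, hm2⟩ := sep_lin (hw 0).symm
  obtain ⟨l, hl, hl1⟩ := exists_lin_ne (hw 0).ne_left
  refine ⟨c * (m * l), hc.mul (hm.mul hl), fun i => ?_, ?_⟩
  · by_cases h : i = 0
    · subst h; simp [hm1]
    · simp [hc1 i h]
  · simp [hc2, hm2, hl1]

/-- quintic through all points, with nonzero derivative at `A i` along `v`. -/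
lemma quint_tan (hA : GP A) (i : Fin 8) {v : Pt} {m : R3} (hm : m.IsHomogeneous 1)
    (hm1 : eval (A i) m = 0) (hm2 : eval v m ≠ 0) :
    ∃ r : R3, r.IsHomogeneous 5 ∧ (∀ k, eval (A k) r = 0) ∧
      ∀ u, dd (A i) u r = 0 ↔ eval u m = 0 := by
  obtain ⟨c, hc, hc1, hc2⟩ := hA.dual i
  obtain ⟨l, hl, hl1⟩ := exists_lin_ne (hA.ne i)
  refine ⟨m * (c * l), ?_, fun k => ?_, fun u => ?_⟩
  · have := hm.mul (hc.mul hl); simpa using this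
  · by_cases h : k = i
    · subst h; simp [hm1]
    · simp [hc1 k h]
  · obtain ⟨n, rfl⟩ := lin_surj hm
    rw [dd_mul, dd_lin, hm1]
    simp [hc2, hl1]

lemma dd_van {a v : Pt} {r n : R3} (hr : eval a r = 0) : dd a v (r * n) = dd a v r * eval a n := by
  rw [dd_mul, hr]; ring

lemma dd_kill {a v : Pt} {f : R3} (h0 : eval a f = 0) (h1 : dd a v f = 0) (b : R3) :
    dd a v (b * f) = 0 := by
  rw [dd_mul, h0, h1]; ring

lemma bez_pp (hA : GP A) (hP : Pencil A p q) {w w' : Pt} (hw : ∀ i, Np w (A i)) (hw' : ∀ i, Np w' (A i))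
    (h1 : eval w p = 0) (h2 : eval w q = 0) (h1' : eval w' p = 0) (h2' : eval w' q = 0) : ¬ Np w w' := by
  intro hnp
  obtain ⟨r, hr, vr, nr⟩ := quint_pt hA hw
  obtain ⟨r', hr', vr', nr'⟩ := quint_pt hA hw'
  obtain ⟨l, hl, hl1⟩ := exists_lin_ne hnp.ne_left
  obtain ⟨n, hn, hn1, hn2⟩ := sep_lin hnp
  refine bez hA hP (ev w) (ev w') (by simp [ev_apply, h1]) (by simp [ev_apply, h2])
    (by simp [ev_apply, h1']) (by simp [ev_apply, h2']) (r * l) (r' * n) (hr.mul hl) (hr'.mul hn)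
    (by simp [vr]) (by simp [vr']) ?_ ?_ ?_ <;> simp [ev_apply, nr, hl1, hn1, hn2, nr']

lemma bez_pt (hA : GP A) (hP : Pencil A p q) {w : Pt} (hw : ∀ i, Np w (A i)) (i : Fin 8) {v : Pt}
    (hv : Np (A i) v)
    (h1 : eval w p = 0) (h2 : eval w q = 0) (h1' : dd (A i) v p = 0) (h2' : dd (A i) v q = 0) : False := by
  obtain ⟨r, hr, vr, nr⟩ := quint_pt hA hw
  obtain ⟨m, hm, hm1, hm2⟩ := sep_lin hv
  obtain ⟨r', hr', vr', nr'⟩ := quint_tan hA i hm hm1 hm2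
  obtain ⟨l, hl, hl1⟩ := exists_lin_ne (hw 0).ne_left
  obtain ⟨n, hn, hn1, hn2⟩ := sep_lin (hw i)
  refine bez hA hP (ev w) (dd (A i) v) (by simp [ev_apply, h1]) (by simp [ev_apply, h2])
    (dd_kill (hP.vp i) h1') (dd_kill (hP.vq i) h2') (r * l) (r' * n) (hr.mul hl) (hr'.mul hn)
    (by simp [vr]) (by simp [vr']) ?_ ?_ ?_
  · simp [ev_apply, nr, hl1]
  · simp [ev_apply, hn1]
  · rw [dd_van (vr' i)]
    exact mul_ne_zero (fun h => hm2 ((nr' v).mp h)) hn2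

lemma bez_tt (hA : GP A) (hP : Pencil A p q) (i k : Fin 8) (hik : i ≠ k) {u v : Pt}
    (hu : Np (A i) u) (hv : Np (A k) v)
    (h1 : dd (A i) u p = 0) (h2 : dd (A i) u q = 0) (h1' : dd (A k) v p = 0) (h2' : dd (A k) v q = 0) :
    False := by
  obtain ⟨m, hm, hm1, hm2⟩ := sep_lin hu
  obtain ⟨r, hr, vr, nr⟩ := quint_tan hA i hm hm1 hm2
  obtain ⟨m', hm', hm1', hm2'⟩ := sep_lin hv
  obtain ⟨r', hr', vr', nr'⟩ := quint_tan hA k hm' hm1' hm2'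
  obtain ⟨l, hl, hl1⟩ := exists_lin_ne (hA.ne i)
  obtain ⟨n, hn, hn1, hn2⟩ := sep_lin (hA.np i k hik)
  refine bez hA hP (dd (A i) u) (dd (A k) v) (dd_kill (hP.vp i) h1) (dd_kill (hP.vq i) h2)
    (dd_kill (hP.vp k) h1') (dd_kill (hP.vq k) h2') (r * l) (r' * n) (hr.mul hl) (hr'.mul hn)
    (by simp [vr]) (by simp [vr']) ?_ ?_ ?_
  · rw [dd_van (vr i)]
    exact mul_ne_zero (fun h => hm2 ((nr u).mp h)) hl1
  · rw [dd_van (vr' i), hn1, mul_zero]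
  · rw [dd_van (vr' k)]
    exact mul_ne_zero (fun h => hm2' ((nr' v).mp h)) hn2

lemma bez_t (hA : GP A) (hP : Pencil A p q) (i : Fin 8) {u v : Pt}
    (huv : dt (A i) u v ≠ 0)
    (h1 : dd (A i) u p = 0) (h2 : dd (A i) u q = 0) (h1' : dd (A i) v p = 0) (h2' : dd (A i) v q = 0) :
    False := by
  obtain ⟨r, hr, vr, nr⟩ := quint_tan hA i (v := u) (ln_hom (A i) v) (ln_left _ _) (by
    rw [eval_ln]; intro h; apply huv; rw [dt] at h ⊢; linear_combination -h)
  obtain ⟨r', hr', vr', nr'⟩ := quint_tan hA i (v := v) (ln_hom (A i) u) (ln_left _ _) (by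
    rwa [eval_ln])
  obtain ⟨l, hl, hl1⟩ := exists_lin_ne (hA.ne i)
  refine bez hA hP (dd (A i) u) (dd (A i) v) (dd_kill (hP.vp i) h1) (dd_kill (hP.vq i) h2)
    (dd_kill (hP.vp i) h1') (dd_kill (hP.vq i) h2') (r * l) (r' * l) (hr.mul hl) (hr'.mul hl)
    (by simp [vr]) (by simp [vr']) ?_ ?_ ?_
  · rw [dd_van (vr i)]
    refine mul_ne_zero (fun h => ?_) hl1
    rw [nr, eval_ln] at h; apply huv; rw [dt] at h ⊢; linear_combination -h
  · rw [dd_van (vr' i), (nr' u).mpr (ln_right _ _), zero_mul]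
  · rw [dd_van (vr' i)]
    refine mul_ne_zero (fun h => ?_) hl1
    rw [nr', eval_ln] at h; exact huv h

end

section

open Topology


lemma dd_bound (a : Pt) (f : R3) : ∃ L : ℝ, 0 ≤ L ∧ ∀ u : Pt, |dd a u f| ≤ L * ‖u‖ := by
  refine ⟨∑ k, |eval a (pderiv k f)|, Finset.sum_nonneg fun _ _ => abs_nonneg _, fun u => ?_⟩
  rw [dd_apply, Finset.sum_mul]
  refine (Finset.abs_sum_le_sum_abs _ _).trans (Finset.sum_le_sum fun k _ => ?_)
  rw [abs_mul, mul_comm]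
  exact mul_le_mul_of_nonneg_left (norm_le_pi_norm u k) (abs_nonneg _)

lemma taylor (a : Pt) (f : R3) : ∃ K : ℝ, 0 ≤ K ∧ ∀ u : Pt, ‖u‖ ≤ 1 →
    |eval (a + u) f - eval a f - dd a u f| ≤ K * ‖u‖ ^ 2 := by
  induction f using MvPolynomial.induction_on with
  | C r => exact ⟨0, le_rfl, fun u _ => by simp [dd_apply]⟩
  | add f g hf hg =>
    obtain ⟨K, hK, h1⟩ := hf
    obtain ⟨L, hL, h2⟩ := hg
    refine ⟨K + L, by positivity, fun u hu => ?_⟩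
    have h3 := h1 u hu
    have h4 := h2 u hu
    simp only [map_add]
    rw [show eval (a + u) f + eval (a + u) g - (eval a f + eval a g) - (dd a u f + dd a u g)
      = (eval (a + u) f - eval a f - dd a u f) + (eval (a + u) g - eval a g - dd a u g) by ring, add_mul]
    exact (abs_add_le _ _).trans (add_le_add h3 h4)
  | mul_X f k hf =>
    obtain ⟨K, hK, h1⟩ := hf
    obtain ⟨L, hL, h2⟩ := dd_bound a f
    refine ⟨K * |a k| + (K + L), by positivity, fun u hu => ?_⟩
    have h3 := h1 u hu
    have h4 := h2 u
    have hdX : dd a u (X k) = u k := by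
      simp [dd_apply, pderiv_X, Pi.single_apply]
    rw [dd_mul, hdX, map_mul, map_mul, eval_X, eval_X, Pi.add_apply]
    rw [show eval (a + u) f * (a k + u k) - eval a f * a k - (dd a u f * a k + eval a f * u k)
      = (eval (a + u) f - eval a f - dd a u f) * a k +
        ((eval (a + u) f - eval a f - dd a u f) + dd a u f) * u k by ring]
    have hn := norm_nonneg u
    have hk : |u k| ≤ ‖u‖ := norm_le_pi_norm u k
    have h5 : |(eval (a + u) f - eval a f - dd a u f) + dd a u f| ≤ (K + L) * ‖u‖ := by
      refine (abs_add_le _ _).trans ?_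
      have : K * ‖u‖ ^ 2 ≤ K * ‖u‖ := mul_le_mul_of_nonneg_left (by nlinarith) hK
      linarith
    refine (abs_add_le _ _).trans ?_
    rw [abs_mul, abs_mul]
    have h6 := mul_le_mul_of_nonneg_right h3 (abs_nonneg (a k))
    have h7 : |(eval (a + u) f - eval a f - dd a u f) + dd a u f| * |u k| ≤ ((K + L) * ‖u‖) * ‖u‖ :=
      mul_le_mul h5 hk (abs_nonneg _) (by positivity)
    nlinarith

lemma taylor_prod (a : Pt) (f g : R3) (hf : eval a f = 0) (hg : eval a g = 0) :
    ∃ K : ℝ, 0 ≤ K ∧ ∀ u : Pt, ‖u‖ ≤ 1 →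
    |eval (a + u) f * eval (a + u) g - dd a u f * dd a u g| ≤ K * ‖u‖ ^ 3 := by
  obtain ⟨K, hK, h1⟩ := taylor a f
  obtain ⟨L, hL, h2⟩ := taylor a g
  obtain ⟨M, hM, h3⟩ := dd_bound a f
  obtain ⟨N, hN, h4⟩ := dd_bound a g
  refine ⟨K * (L + N) + M * L, by positivity, fun u hu => ?_⟩
  have e1 := h1 u hu
  have e2 := h2 u hu
  have e3 := h3 u
  have e4 := h4 u
  rw [hf, sub_zero] at e1
  rw [hg, sub_zero] at e2
  have hn := norm_nonneg u
  have e5 : |eval (a + u) g| ≤ (L + N) * ‖u‖ := by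
    have : |eval (a + u) g| ≤ |eval (a + u) g - dd a u g| + |dd a u g| := by
      simpa using abs_add_le (eval (a + u) g - dd a u g) (dd a u g)
    have h : L * ‖u‖ ^ 2 ≤ L * ‖u‖ := mul_le_mul_of_nonneg_left (by nlinarith) hL
    linarith
  rw [show eval (a + u) f * eval (a + u) g - dd a u f * dd a u g
    = (eval (a + u) f - dd a u f) * eval (a + u) g + dd a u f * (eval (a + u) g - dd a u g) by ring]
  refine (abs_add_le _ _).trans ?_
  rw [abs_mul, abs_mul]
  have h6 : |eval (a + u) f - dd a u f| * |eval (a + u) g| ≤ (K * ‖u‖ ^ 2) * ((L + N) * ‖u‖) :=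
    mul_le_mul e1 e5 (abs_nonneg _) (by positivity)
  have h7 : |dd a u f| * |eval (a + u) g - dd a u g| ≤ (M * ‖u‖) * (L * ‖u‖ ^ 2) :=
    mul_le_mul e3 e2 (abs_nonneg _) (by positivity)
  nlinarith

lemma cpt {X : Type*} [TopologicalSpace X] {S : Set X} (hS : IsCompact S) {N M : X → ℝ}
    (hN : Continuous N) (hM : Continuous M) (hN0 : ∀ x, 0 ≤ N x) (h : ∀ x ∈ S, N x = 0 → 0 < M x) :
    ∃ ε c : ℝ, 0 < ε ∧ 0 < c ∧ ∀ x ∈ S, c ≤ N x + ε * M x := by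
  refine hS.induction_on (p := fun s => ∃ ε c : ℝ, 0 < ε ∧ 0 < c ∧ ∀ x ∈ s, c ≤ N x + ε * M x)
    ⟨1, 1, one_pos, one_pos, by simp⟩ ?_ ?_ ?_
  · rintro s t hst ⟨ε, c, h1, h2, h3⟩
    exact ⟨ε, c, h1, h2, fun x hx => h3 x (hst hx)⟩
  · have key : ∀ (s : Set X) (ε c ε' : ℝ), 0 < ε → 0 < c → 0 < ε' → ε' ≤ ε →
        (∀ x ∈ s, c ≤ N x + ε * M x) → ∀ x ∈ s, (ε' / ε) * c ≤ N x + ε' * M x := by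
      intro s ε c ε' h1 h2 h3 h4 h5 x hx
      have h6 := h5 x hx
      have h7 : ε' / ε ≤ 1 := (div_le_one h1).mpr h4
      have h8 : 0 < ε' / ε := by positivity
      have h9 : N x + ε' * M x = (1 - ε' / ε) * N x + (ε' / ε) * (N x + ε * M x) := by
        field_simp; ring
      rw [h9]
      have := mul_nonneg (sub_nonneg.mpr h7) (hN0 x)
      have := mul_le_mul_of_nonneg_left h6 h8.le
      linarith
    rintro s t ⟨ε, c, h1, h2, h3⟩ ⟨ε', c', h1', h2', h3'⟩
    have hm : 0 < min ε ε' := lt_min h1 h1'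
    refine ⟨min ε ε', min (min ε ε' / ε * c) (min ε ε' / ε' * c'), hm, by positivity, ?_⟩
    rintro x (hx | hx)
    · exact (min_le_left _ _).trans (key s ε c _ h1 h2 hm (min_le_left _ _) h3 x hx)
    · exact (min_le_right _ _).trans (key t ε' c' _ h1' h2' hm (min_le_right _ _) h3' x hx)
  · intro x hx
    obtain ⟨ε, hε, hpos⟩ : ∃ ε : ℝ, 0 < ε ∧ 0 < N x + ε * M x := by
      rcases (hN0 x).eq_or_lt with h0 | h0
      · exact ⟨1, one_pos, by rw [← h0]; simpa using h x hx h0.symm⟩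
      · refine ⟨N x / (2 * (|M x| + 1)), by positivity, ?_⟩
        have h1 : N x / (2 * (|M x| + 1)) * |M x| ≤ N x / 2 := by
          rw [div_mul_eq_mul_div, div_le_div_iff₀ (by positivity) (by positivity)]
          nlinarith [abs_nonneg (M x)]
        have h2 := neg_abs_le (M x)
        have h3 := mul_le_mul_of_nonneg_left h2 (show 0 ≤ N x / (2 * (|M x| + 1)) by positivity)
        linarith
    have hcont : Continuous fun y => N y + ε * M y := by fun_prop
    have hev : ∀ᶠ y in 𝓝 x, (N x + ε * M x) / 2 < N y + ε * M y :=
      hcont.continuousAt.eventually (lt_mem_nhds (by linarith))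
    exact ⟨_, mem_nhdsWithin_of_mem_nhds hev, ε, _, hε, half_pos hpos, fun y hy => le_of_lt hy⟩

def dp (a u : Pt) : ℝ := a 0 * u 0 + a 1 * u 1 + a 2 * u 2

lemma dp_cont (a : Pt) : Continuous (dp a) := by unfold dp; fun_prop

lemma dp_self {a : Pt} (h : a ≠ 0) : 0 < dp a a := by
  have : 0 ≤ dp a a := by unfold dp; nlinarith [mul_self_nonneg (a 0), mul_self_nonneg (a 1), mul_self_nonneg (a 2)]
  rcases this.eq_or_lt with h0 | h0
  · exfalso; apply h
    unfold dp at h0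
    have e0 : a 0 = 0 := by nlinarith [mul_self_nonneg (a 0), mul_self_nonneg (a 1), mul_self_nonneg (a 2)]
    have e1 : a 1 = 0 := by nlinarith [mul_self_nonneg (a 0), mul_self_nonneg (a 1), mul_self_nonneg (a 2)]
    have e2 : a 2 = 0 := by nlinarith [mul_self_nonneg (a 0), mul_self_nonneg (a 1), mul_self_nonneg (a 2)]
    ext i; fin_cases i <;> simpa
  · exact h0

lemma dd_cont (a : Pt) (f : R3) : Continuous fun u => dd a u f := by
  simp only [dd_apply]; fun_prop

lemma dd_smul (a : Pt) (t : ℝ) (u : Pt) (f : R3) : dd a (t • u) f = t * dd a u f := by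
  simp [dd_apply, Finset.mul_sum, mul_assoc]

/-- local positivity on the slice -/
lemma local_slice {a : Pt} {p q f : R3} (hp : eval a p = 0) (hq : eval a q = 0)
    (M : Pt → ℝ) (hM : Continuous M) (hMh : ∀ (t : ℝ) u, M (t • u) = t ^ 2 * M u)
    (K : ℝ) (hK0 : 0 ≤ K) (hf : ∀ u : Pt, ‖u‖ ≤ 1 → M u - K * ‖u‖ ^ 3 ≤ eval (a + u) f)
    (hpos : ∀ u : Pt, u ≠ 0 → dp a u = 0 → dd a u p = 0 → dd a u q = 0 → 0 < M u) :
    ∃ ε δ : ℝ, 0 < ε ∧ 0 < δ ∧ ∀ u : Pt, dp a u = 0 → ‖u‖ ≤ δ →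
      0 ≤ eval (a + u) (p ^ 2 + q ^ 2 + C ε * f) := by
  have hS : IsCompact (Metric.sphere (0 : Pt) 1 ∩ {u | dp a u = 0}) :=
    (isCompact_sphere _ _).inter_right (isClosed_eq (dp_cont a) continuous_const)
  obtain ⟨ε, c, hε, hc, h⟩ := cpt hS (N := fun u => dd a u p ^ 2 + dd a u q ^ 2) (M := M)
    (((dd_cont a p).pow 2).add ((dd_cont a q).pow 2)) hM (fun u => by positivity) (by
      rintro u ⟨hu1, hu2⟩ hN
      have h1 : dd a u p = 0 := by nlinarith [sq_nonneg (dd a u p), sq_nonneg (dd a u q)]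
      have h2 : dd a u q = 0 := by nlinarith [sq_nonneg (dd a u p), sq_nonneg (dd a u q)]
      refine hpos u ?_ hu2 h1 h2
      rintro rfl
      simp at hu1)
  have hh : ∀ u : Pt, dp a u = 0 → c * ‖u‖ ^ 2 ≤ dd a u p ^ 2 + dd a u q ^ 2 + ε * M u := by
    intro u hu
    by_cases hu0 : u = 0
    · subst hu0
      have : M 0 = 0 := by simpa using hMh 0 0
      simp [this, dd_apply]
    · have hn : ‖u‖ ≠ 0 := norm_ne_zero_iff.mpr hu0
      obtain ⟨v, hv⟩ : ∃ v : Pt, v = ‖u‖⁻¹ • u := ⟨_, rfl⟩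
      have huv : u = ‖u‖ • v := by rw [hv, smul_smul, mul_inv_cancel₀ hn, one_smul]
      have h1 := h v ⟨by simp [hv, norm_smul, hn], by
        show dp a v = 0
        have : dp a v = ‖u‖⁻¹ * dp a u := by rw [hv]; simp [dp]; ring
        rw [this, hu, mul_zero]⟩
      have h2 : dd a u p = ‖u‖ * dd a v p := by rw [← dd_smul, ← huv]
      have h3 : dd a u q = ‖u‖ * dd a v q := by rw [← dd_smul, ← huv]
      have h4 : M u = ‖u‖ ^ 2 * M v := by rw [← hMh, ← huv]
      rw [h2, h3, h4]
      have := mul_le_mul_of_nonneg_left h1 (sq_nonneg ‖u‖)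
      linarith
  obtain ⟨Kp, hKp, tp⟩ := taylor_prod a p p hp hp
  obtain ⟨Kq, hKq, tq⟩ := taylor_prod a q q hq hq
  have hL : 0 < Kp + Kq + ε * K + 1 := by positivity
  refine ⟨ε, min 1 (c / (Kp + Kq + ε * K + 1)), hε, lt_min one_pos (div_pos hc hL), fun u hu hn => ?_⟩
  have hn1 := hn.trans (min_le_left _ _)
  have hn2 := hn.trans (min_le_right _ _)
  rw [le_div_iff₀ hL] at hn2
  have t1 := (abs_le.mp (tp u hn1)).1
  have t2 := (abs_le.mp (tq u hn1)).1
  have t3 := mul_le_mul_of_nonneg_left (hf u hn1) hε.le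
  have t4 := hh u hu
  have hn0 := norm_nonneg u
  simp only [map_add, map_mul, map_pow, eval_C]
  have t5 : ‖u‖ ^ 3 * (Kp + Kq + ε * K + 1) ≤ c * ‖u‖ ^ 2 := by
    have := mul_le_mul_of_nonneg_right hn2 (sq_nonneg ‖u‖)
    nlinarith
  have t6 : 0 ≤ ‖u‖ ^ 3 := by positivity
  nlinarith

/-- from the slice to a neighbourhood -/
lemma slice_nhds {a : Pt} (ha : a ≠ 0) {g : R3} (hg : g.IsHomogeneous 6) {δ : ℝ} (hδ : 0 < δ)
    (h : ∀ u : Pt, dp a u = 0 → ‖u‖ ≤ δ → 0 ≤ eval (a + u) g) : ∀ᶠ x in 𝓝 a, 0 ≤ eval x g := by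
  have ha2 := dp_self ha
  have hc1 : ContinuousAt (fun x => (dp a x / dp a a)⁻¹ • x - a) a := by
    have h1 : ContinuousAt (fun x => dp a x / dp a a) a := ((dp_cont a).div_const _).continuousAt
    have h2 : ContinuousAt (fun x => (dp a x / dp a a)⁻¹) a :=
      h1.inv₀ (by rw [div_self ha2.ne']; exact one_ne_zero)
    have h3 : ContinuousAt (fun x => (dp a x / dp a a)⁻¹ • x) a := h2.smul continuousAt_id
    exact h3.sub continuousAt_const
  have e1 : ∀ᶠ x in 𝓝 a, ‖(dp a x / dp a a)⁻¹ • x - a‖ < δ := by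
    have h0 : ‖(dp a a / dp a a)⁻¹ • a - a‖ < δ := by
      rw [div_self ha2.ne', inv_one, one_smul, sub_self, norm_zero]; exact hδ
    exact hc1.norm.eventually (gt_mem_nhds h0)
  have e2 : ∀ᶠ x in 𝓝 a, 0 < dp a x := (dp_cont a).continuousAt.eventually (lt_mem_nhds ha2)
  filter_upwards [e1, e2] with x h1 h2
  have ht : dp a x / dp a a ≠ 0 := (div_pos h2 ha2).ne'
  have hx : x = (dp a x / dp a a) • (a + ((dp a x / dp a a)⁻¹ • x - a)) := by
    rw [add_sub_cancel, smul_smul, mul_inv_cancel₀ ht, one_smul]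
  rw [hx, hom_ev hg]
  refine mul_nonneg (by positivity) (h _ ?_ h1.le)
  have : dp a ((dp a x / dp a a)⁻¹ • x - a) = (dp a x / dp a a)⁻¹ * dp a x - dp a a := by
    simp [dp]; ring
  rw [this]
  field_simp
  ring

end

section

open Topology


variable {A : Fin 8 → Pt} {p q f : R3}

lemma psd_of (hA : GP A) (hP : Pencil A p q) (hf : f.IsHomogeneous 6)
    (hext : ∀ x : Pt, (∀ i, Np x (A i)) → eval x p = 0 → eval x q = 0 → 0 < eval x f)
    (hloc : ∀ i, ∃ ε δ : ℝ, 0 < ε ∧ 0 < δ ∧ ∀ u : Pt, dp (A i) u = 0 → ‖u‖ ≤ δ →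
      0 ≤ eval (A i + u) (p ^ 2 + q ^ 2 + C ε * f)) :
    ∃ ε : ℝ, 0 < ε ∧ Psd (p ^ 2 + q ^ 2 + C ε * f) := by
  have hom : ∀ ε : ℝ, (p ^ 2 + q ^ 2 + C ε * f).IsHomogeneous 6 := fun ε =>
    ((hP.hp.pow 2).add (hP.hq.pow 2)).add (hf.C_mul ε)
  have hev : ∀ (ε : ℝ) (x : Pt), eval x (p ^ 2 + q ^ 2 + C ε * f)
      = (eval x p ^ 2 + eval x q ^ 2) + ε * eval x f := by intro ε x; simp
  have mono : ∀ (ε ε' : ℝ) (x : Pt), 0 < ε' → ε' ≤ ε → 0 ≤ eval x (p ^ 2 + q ^ 2 + C ε * f) →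
      0 ≤ eval x (p ^ 2 + q ^ 2 + C ε' * f) := by
    intro ε ε' x h1 h2 h3
    rw [hev] at h3 ⊢
    by_cases h : 0 ≤ eval x f
    · positivity
    · push Not at h
      nlinarith [sq_nonneg (eval x p), sq_nonneg (eval x q)]
  have main : ∃ ε : ℝ, 0 < ε ∧ ∀ x ∈ Metric.sphere (0 : Pt) 1, 0 ≤ eval x (p ^ 2 + q ^ 2 + C ε * f) := by
    refine (isCompact_sphere (0 : Pt) 1).induction_on
      (p := fun s => ∃ ε : ℝ, 0 < ε ∧ ∀ x ∈ s, 0 ≤ eval x (p ^ 2 + q ^ 2 + C ε * f))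
      ⟨1, one_pos, by simp⟩ ?_ ?_ ?_
    · rintro s t hst ⟨ε, h1, h2⟩
      exact ⟨ε, h1, fun x hx => h2 x (hst hx)⟩
    · rintro s t ⟨ε, h1, h2⟩ ⟨ε', h1', h2'⟩
      refine ⟨min ε ε', lt_min h1 h1', ?_⟩
      rintro x (hx | hx)
      · exact mono _ _ x (lt_min h1 h1') (min_le_left _ _) (h2 x hx)
      · exact mono _ _ x (lt_min h1 h1') (min_le_right _ _) (h2' x hx)
    · intro x hx
      have hx0 : x ≠ 0 := by rintro rfl; simp at hx
      by_cases hnp : ∀ i, Np x (A i)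
      · obtain ⟨ε, c, hε, hc, h⟩ := cpt (isCompact_singleton (x := x))
          (N := fun x => eval x p ^ 2 + eval x q ^ 2) (M := fun x => eval x f)
          (((MvPolynomial.continuous_eval p).pow 2).add ((MvPolynomial.continuous_eval q).pow 2))
          (MvPolynomial.continuous_eval f) (fun u => by positivity) (by
            rintro y hy hN
            have hy' : y = x := hy
            subst hy'
            have h1 : eval y p = 0 := by nlinarith [sq_nonneg (eval y p), sq_nonneg (eval y q)]
            have h2 : eval y q = 0 := by nlinarith [sq_nonneg (eval y p), sq_nonneg (eval y q)]
            exact hext y hnp h1 h2)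
        have hx1 := h x rfl
        have hpos : 0 < eval x (p ^ 2 + q ^ 2 + C ε * f) := by rw [hev]; exact hc.trans_le hx1
        have he : ∀ᶠ y in 𝓝 x, 0 < eval y (p ^ 2 + q ^ 2 + C ε * f) :=
          (MvPolynomial.continuous_eval _).continuousAt.eventually (lt_mem_nhds hpos)
        exact ⟨_, mem_nhdsWithin_of_mem_nhds he, ε, hε, fun y hy => le_of_lt hy⟩
      · push Not at hnp
        obtain ⟨i, hi⟩ := hnp
        obtain ⟨c, rfl⟩ := smul_of_not_np (hA.ne i) (fun h => hi h.symm)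
        have hc : c ≠ 0 := by rintro rfl; simp at hx0
        obtain ⟨ε, δ, hε, hδ, h⟩ := hloc i
        have h1 := slice_nhds (hA.ne i) (hom ε) hδ h
        have hcont : ContinuousAt (fun y : Pt => c⁻¹ • y) (c • A i) := by fun_prop
        have he : ∀ᶠ y in 𝓝 (c • A i), 0 ≤ eval (c⁻¹ • y) (p ^ 2 + q ^ 2 + C ε * f) := by
          apply hcont.eventually (p := fun z => 0 ≤ eval z (p ^ 2 + q ^ 2 + C ε * f))
          show ∀ᶠ y in 𝓝 (c⁻¹ • c • A i), 0 ≤ eval y (p ^ 2 + q ^ 2 + C ε * f)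
          rwa [smul_smul, inv_mul_cancel₀ hc, one_smul]
        refine ⟨_, mem_nhdsWithin_of_mem_nhds he, ε, hε, fun y hy => ?_⟩
        have hy' : 0 ≤ eval (c⁻¹ • y) (p ^ 2 + q ^ 2 + C ε * f) := hy
        rw [hom_ev (hom ε)] at hy'
        exact nonneg_of_mul_nonneg_right hy' (by positivity)
  obtain ⟨ε, hε, h⟩ := main
  refine ⟨ε, hε, fun u => ?_⟩
  by_cases hu : u = 0
  · have := hom_ev (hom ε) 0 u
    rw [zero_smul] at this
    rw [hu, this]; simp
  · have hn : ‖u‖ ≠ 0 := norm_ne_zero_iff.mpr hu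
    have h1 := h (‖u‖⁻¹ • u) (by simp [norm_smul, hn])
    rw [hom_ev (hom ε)] at h1
    exact nonneg_of_mul_nonneg_right h1 (by positivity)

lemma td_drop {h : R3} {d : ℕ} (h1 : h.totalDegree ≤ d + 1) (h2 : homogeneousComponent (d + 1) h = 0) :
    h.totalDegree ≤ d := by
  rw [totalDegree]
  refine Finset.sup_le fun s hs => ?_
  have h3 := le_totalDegree hs
  rcases (h3.trans h1).eq_or_lt with h4 | h4
  · exfalso
    have := coeff_homogeneousComponent (d + 1) h s
    rw [h2, if_pos (by rw [← h4]; rfl)] at this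
    exact (mem_support_iff.mp hs) (by simpa using this.symm)
  · omega

lemma sum_sq_zero {n : ℕ} {u : Fin n → R3} (h : ∑ i, u i * u i = 0) (i : Fin n) : u i = 0 := by
  apply MvPolynomial.funext
  intro x
  have h1 := congrArg (eval x) h
  rw [map_sum, map_zero, Finset.sum_eq_zero_iff_of_nonneg (by
    intro i _; rw [map_mul]; exact mul_self_nonneg _)] at h1
  have := h1 i (Finset.mem_univ i)
  rw [map_mul, mul_self_eq_zero] at this
  simpa using this

def W3 (p q : R3) : Submodule ℝ R3 := Submodule.span ℝ {p * p, p * q, q * q}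

lemma not_sos (hP : Pencil A p q) (hf : f.IsHomogeneous 6) (hfv : ∀ i, eval (A i) f = 0)
    (hW : f ∉ W3 p q) {ε : ℝ} (hε : 0 < ε) : ¬ Sos (p ^ 2 + q ^ 2 + C ε * f) := by
  rintro ⟨n, h, hg⟩
  have hom : (p ^ 2 + q ^ 2 + C ε * f).IsHomogeneous 6 :=
    ((hP.hp.pow 2).add (hP.hq.pow 2)).add (hf.C_mul ε)
  have hgv : ∀ i, eval (A i) (p ^ 2 + q ^ 2 + C ε * f) = 0 := by
    intro i; simp [hP.vp, hP.vq, hfv]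
  simp only [sq (h _)] at hg
  generalize hgg : p ^ 2 + q ^ 2 + C ε * f = g at *
  have top : ∀ d, (∀ i, (h i).totalDegree ≤ d) →
      homogeneousComponent (d + d) g = ∑ i, homogeneousComponent d (h i) * homogeneousComponent d (h i) := by
    intro d hd
    rw [hg, map_sum]
    exact Finset.sum_congr rfl fun i _ => top_mul (hd i) (hd i)
  have drop : ∀ k, (∀ i, (h i).totalDegree ≤ 3 + k) → ∀ i, (h i).totalDegree ≤ 3 := by
    intro k
    induction k with
    | zero => exact fun h => h
    | succ k ih =>
      intro hk
      apply ih
      intro i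
      apply td_drop (hk i)
      have h1 := top (3 + (k + 1)) hk
      have h2 : homogeneousComponent (3 + (k + 1) + (3 + (k + 1))) g = 0 := by
        rw [homogeneousComponent_of_mem hom, if_neg (by omega)]
      rw [h2] at h1
      exact sum_sq_zero h1.symm i
  have h3 : ∀ i, (h i).totalDegree ≤ 3 := by
    apply drop (∑ i, (h i).totalDegree)
    intro i
    have := Finset.single_le_sum (f := fun i => (h i).totalDegree) (fun i _ => Nat.zero_le _) (Finset.mem_univ i)
    omega
  have hg3 := top 3 h3
  rw [show 3 + 3 = 6 from rfl, homogeneousComponent_eq_self hom] at hg3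
  have hv : ∀ i k, eval (A k) (homogeneousComponent 3 (h i)) = 0 := by
    intro i k
    have h1 := congrArg (eval (A k)) hg3
    rw [hgv k, map_sum, eq_comm, Finset.sum_eq_zero_iff_of_nonneg (by
      intro i _; rw [map_mul]; exact mul_self_nonneg _)] at h1
    have := h1 i (Finset.mem_univ i)
    rw [map_mul, mul_self_eq_zero] at this
    exact this
  have m1 : p * p ∈ W3 p q := Submodule.subset_span (by simp)
  have m2 : p * q ∈ W3 p q := Submodule.subset_span (by simp)
  have m3 : q * q ∈ W3 p q := Submodule.subset_span (by simp)
  have hgW : g ∈ W3 p q := by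
    rw [hg3]
    refine Submodule.sum_mem _ fun i _ => ?_
    obtain ⟨α, β, hab⟩ := hP.span _ (homogeneousComponent_isHomogeneous 3 (h i)) (hv i)
    rw [hab]
    have : (C α * p + C β * q) * (C α * p + C β * q)
        = (α * α) • (p * p) + (2 * α * β) • (p * q) + (β * β) • (q * q) := by
      simp only [smul_eq_C_mul, C_mul]
      rw [show (C (2 : ℝ) : R3) = 2 from rfl]
      ring
    rw [this]
    exact add_mem (add_mem (Submodule.smul_mem _ _ m1) (Submodule.smul_mem _ _ m2)) (Submodule.smul_mem _ _ m3)
  apply hW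
  have : f = ε⁻¹ • (g - p * p - q * q) := by
    rw [← hgg, smul_eq_C_mul]
    have : (C ε⁻¹ * C ε : R3) = 1 := by rw [← C_mul, inv_mul_cancel₀ hε.ne', C_1]
    linear_combination -this * f
  rw [this]
  exact Submodule.smul_mem _ _ (sub_mem (sub_mem hgW m1) m3)

/-- transversality at `A i` -/
def Tr (a : Pt) (p q : R3) : Prop := ∀ v, dp a v = 0 → dd a v p = 0 → dd a v q = 0 → v = 0

lemma np_of_dp {a v : Pt} (ha : a ≠ 0) (h : dp a v = 0) (hv : v ≠ 0) : Np a v := by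
  by_contra hn
  obtain ⟨c, rfl⟩ := smul_of_not_np ha hn
  have h1 : dp a (c • a) = c * dp a a := by simp [dp]; ring
  rw [h1, mul_eq_zero] at h
  rcases h with rfl | h
  · simp at hv
  · linarith [dp_self ha]

/-- singular forms and transversality give the local estimate -/
lemma local_tr {a : Pt} (hp : eval a p = 0) (hq : eval a q = 0) (hT : Tr a p q)
    (hf0 : eval a f = 0) (hf1 : ∀ u, dd a u f = 0) :
    ∃ ε δ : ℝ, 0 < ε ∧ 0 < δ ∧ ∀ u : Pt, dp a u = 0 → ‖u‖ ≤ δ →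
      0 ≤ eval (a + u) (p ^ 2 + q ^ 2 + C ε * f) := by
  obtain ⟨K, hK, h⟩ := taylor a f
  refine local_slice hp hq (fun u => - (K * ‖u‖ ^ 2)) (by fun_prop) ?_ 0 le_rfl ?_ ?_
  · intro t u
    rw [norm_smul, mul_pow, Real.norm_eq_abs, sq_abs]; ring
  · intro u hu
    have := h u hu
    rw [hf0, hf1, sub_zero, sub_zero] at this
    have := (abs_le.mp this).1
    simpa using this
  · intro u hu h1 h2 h3
    exact absurd (hT u h1 h2 h3) hu

lemma exists_ker2 (a : Pt) (r : R3) (b : Pt) : ∃ v : Pt, v ≠ 0 ∧ dp a v = 0 ∧ dd b v r = 0 := by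
  let L : Pt →ₗ[ℝ] (Fin 2 → ℝ) :=
    { toFun := fun v => ![dp a v, dd b v r]
      map_add' := by
        intro x y; ext i; fin_cases i
        · simp [dp]; ring
        · simp [dd_apply, add_mul, Finset.sum_add_distrib]
      map_smul' := by
        intro t x; ext i; fin_cases i
        · simp [dp]; ring
        · simp [dd_smul] }
  have hL : LinearMap.ker L ≠ ⊥ := LinearMap.ker_ne_bot_of_finrank_lt (by simp)
  obtain ⟨v, hv, hv0⟩ := Submodule.exists_mem_ne_zero_of_ne_bot hL
  have h1 : ![dp a v, dd b v r] = 0 := hv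
  exact ⟨v, hv0, by simpa using congrFun h1 0, by simpa using congrFun h1 1⟩

lemma euler {n : ℕ} (hn : n ≠ 0) (hf : f.IsHomogeneous n) {a : Pt} (h : ∀ k, eval a (pderiv k f) = 0) :
    eval a f = 0 := by
  have h1 := congrArg (eval a) hf.sum_X_mul_pderiv
  simp [h] at h1
  exact h1.resolve_left hn

/-- the special cubics -/
lemma cub (hP : Pencil A p q) {a b : Fin 8} (hab : a ≠ b) (hT : Tr (A a) p q) :
    ∃ c : R3, c.IsHomogeneous 3 ∧ (∀ u, dd (A a) u c = 0) ∧ (∀ k, k ≠ b → eval (A k) c = 0) ∧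
      eval (A b) c ≠ 0 := by
  let Φ : R3 →ₗ[ℝ] ((Fin 3 ⊕ {k : Fin 8 // k ≠ a ∧ k ≠ b}) → ℝ) :=
    LinearMap.pi (Sum.elim (fun k => ev (A a) ∘ₗ (pderiv k).toLinearMap)
      (fun k : {k : Fin 8 // k ≠ a ∧ k ≠ b} => ev (A k.1)))
  obtain ⟨c, hc0, hc, hcΦ⟩ := exists_form 3 Φ (by
    rw [Fintype.card_sum, Fintype.card_fin, Fintype.card_subtype]
    have : (Finset.univ.filter fun k : Fin 8 => k ≠ a ∧ k ≠ b) = Finset.univ \ {a, b} := by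
      ext k; simp
    rw [this, Finset.card_sdiff_of_subset (by simp), Finset.card_pair hab]
    decide)
  have h1 : ∀ k, eval (A a) (pderiv k c) = 0 := by
    intro k
    have := congrFun hcΦ (Sum.inl k)
    simpa [Φ, ev_apply] using this
  have h2 : ∀ k, k ≠ a → k ≠ b → eval (A k) c = 0 := by
    intro k hka hkb
    have := congrFun hcΦ (Sum.inr ⟨k, hka, hkb⟩)
    simpa [Φ, ev_apply] using this
  have h3 : eval (A a) c = 0 := euler (by norm_num) hc h1
  have h4 : ∀ u, dd (A a) u c = 0 := by intro u; simp [dd_apply, h1]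
  have h5 : ∀ k, k ≠ b → eval (A k) c = 0 := by
    intro k hk
    by_cases h : k = a
    · rw [h]; exact h3
    · exact h2 k h hk
  refine ⟨c, hc, h4, h5, fun hb => hc0 ?_⟩
  obtain ⟨α, β, hc'⟩ := hP.span c hc (by
    intro k; by_cases h : k = b
    · rw [h]; exact hb
    · exact h5 k h)
  have h6 : ∀ u, α * dd (A a) u p + β * dd (A a) u q = 0 := by
    intro u
    have := h4 u
    rw [hc', map_add, ← smul_eq_C_mul, ← smul_eq_C_mul, map_smul, map_smul] at this
    simpa using this
  have hα : α = 0 := by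
    by_contra hα
    obtain ⟨v, hv0, hv1, hv2⟩ := exists_ker2 (A a) q (A a)
    have := h6 v
    rw [hv2, mul_zero, add_zero, mul_eq_zero] at this
    exact hv0 (hT v hv1 (this.resolve_left hα) hv2)
  have hβ : β = 0 := by
    by_contra hβ
    obtain ⟨v, hv0, hv1, hv2⟩ := exists_ker2 (A a) p (A a)
    have := h6 v
    rw [hv2, mul_zero, zero_add, mul_eq_zero] at this
    exact hv0 (hT v hv1 hv2 (this.resolve_left hβ))
  rw [hc', hα, hβ]; simp

/-- a functional vanishing on the pencil but not on cubics through all but `A b` is nonzero on `c`. -/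
lemma funct_ne (hP : Pencil A p q) {b : Fin 8} {c d : R3} (hc : c.IsHomogeneous 3) (hd : d.IsHomogeneous 3)
    (hcv : ∀ k, k ≠ b → eval (A k) c = 0) (hdv : ∀ k, k ≠ b → eval (A k) d = 0)
    (hcb : eval (A b) c ≠ 0) (ψ : R3 →ₗ[ℝ] ℝ) (h1 : ψ p = 0) (h2 : ψ q = 0) (h3 : ψ d ≠ 0) : ψ c ≠ 0 := by
  intro h0
  apply h3
  obtain ⟨α, β, h⟩ := hP.span (d - C (eval (A b) d / eval (A b) c) * c) (hd.sub (hc.C_mul _)) (by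
    intro k; by_cases hk : k = b
    · rw [hk]; simp [hcb]
    · simp [hcv k hk, hdv k hk])
  have h4 := congrArg ψ h
  rw [map_sub, map_add, ← smul_eq_C_mul, ← smul_eq_C_mul, ← smul_eq_C_mul, map_smul, map_smul, map_smul,
    h0, h1, h2] at h4
  simpa using h4

end

section

variable {A : Fin 8 → Pt} {p q f : R3}

lemma pair (hP : Pencil A p q) {a b : Fin 8} (hab : a ≠ b) (hTa : Tr (A a) p q) (hTb : Tr (A b) p q)
    (ψ : R3 →ₗ[ℝ] ℝ) (h1 : ψ p = 0) (h2 : ψ q = 0)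
    (hda : ∃ d : R3, d.IsHomogeneous 3 ∧ (∀ k, k ≠ a → eval (A k) d = 0) ∧ ψ d ≠ 0)
    (hdb : ∃ d : R3, d.IsHomogeneous 3 ∧ (∀ k, k ≠ b → eval (A k) d = 0) ∧ ψ d ≠ 0) :
    ∃ c e : R3, c.IsHomogeneous 3 ∧ e.IsHomogeneous 3 ∧ ψ c ≠ 0 ∧ ψ e ≠ 0 ∧
      (∀ k, eval (A k) (c * e) = 0) ∧ (∀ k u, dd (A k) u (c * e) = 0) ∧
      (∀ k, k ≠ a → k ≠ b → eval (A k) c = 0 ∧ eval (A k) e = 0) := by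
  obtain ⟨c, hc, c1, c2, c3⟩ := cub hP hab hTa
  obtain ⟨e, he, e1, e2, e3⟩ := cub hP hab.symm hTb
  obtain ⟨d, hd, d1, d2⟩ := hda
  obtain ⟨d', hd', d1', d2'⟩ := hdb
  refine ⟨c, e, hc, he, funct_ne hP hc hd' c2 d1' c3 ψ h1 h2 d2', funct_ne hP he hd e2 d1 e3 ψ h1 h2 d2,
    ?_, ?_, fun k ha hb => ⟨c2 k hb, e2 k ha⟩⟩
  · intro k
    rw [map_mul]
    by_cases h : k = b
    · rw [e2 k (by rw [h]; exact hab.symm), mul_zero]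
    · rw [c2 k h, zero_mul]
  · intro k u
    rw [dd_mul]
    by_cases h : k = b
    · rw [e2 k (by rw [h]; exact hab.symm), h, e1]; simp
    · rw [c2 k h]
      by_cases h' : k = a
      · rw [h', c1]; simp
      · rw [e2 k h']; simp

lemma not_mem_W3 (ψ : R3 →ₗ[ℝ] ℝ) (h1 : ψ (p * p) = 0) (h2 : ψ (p * q) = 0) (h3 : ψ (q * q) = 0)
    (h : ψ f ≠ 0) : f ∉ W3 p q := by
  intro hf
  have : W3 p q ≤ LinearMap.ker ψ := by
    rw [W3, Submodule.span_le]
    rintro x (rfl | rfl | rfl) <;> simpa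
  exact h (this hf)

/-- The data wanted of `f`. -/
structure Good (A : Fin 8 → Pt) (p q f : R3) : Prop where
  hom : f.IsHomogeneous 6
  van : ∀ i, eval (A i) f = 0
  out : f ∉ W3 p q
  ext : ∀ x : Pt, (∀ i, Np x (A i)) → eval x p = 0 → eval x q = 0 → 0 < eval x f
  loc : ∀ i, ∃ ε δ : ℝ, 0 < ε ∧ 0 < δ ∧ ∀ u : Pt, dp (A i) u = 0 → ‖u‖ ≤ δ →
      0 ≤ eval (A i + u) (p ^ 2 + q ^ 2 + C ε * f)

lemma case_ext (hA : GP A) (hP : Pencil A p q) {w : Pt} (hw : ∀ i, Np w (A i))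
    (h1 : eval w p = 0) (h2 : eval w q = 0) : ∃ f, Good A p q f := by
  have hT : ∀ i, Tr (A i) p q := by
    intro i v hv hp hq
    by_contra h0
    exact bez_pt hA hP hw i (np_of_dp (hA.ne i) hv h0) h1 h2 hp hq
  have hs : ∀ j, ∃ d : R3, d.IsHomogeneous 3 ∧ (∀ k, k ≠ j → eval (A k) d = 0) ∧ ev w d ≠ 0 := by
    intro j
    obtain ⟨d, hd, d1, d2⟩ := sep_point hA j w (fun i _ => hw i)
    exact ⟨d, hd, d1, by rwa [ev_apply]⟩
  obtain ⟨c, e, hc, he, c0, e0, v0, v1, -⟩ := pair hP (a := 0) (b := 1) (by decide) (hT 0) (hT 1) (ev w)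
    (by rwa [ev_apply]) (by rwa [ev_apply]) (hs 0) (hs 1)
  rw [ev_apply] at c0 e0
  have hfw : 0 < eval w (C (eval w c * eval w e) * (c * e)) := by
    rw [map_mul (eval w), eval_C, map_mul (eval w)]
    exact mul_self_pos.mpr (mul_ne_zero c0 e0)
  have hom : (C (eval w c * eval w e) * (c * e)).IsHomogeneous 6 := (hc.mul he).C_mul _
  refine ⟨C (eval w c * eval w e) * (c * e), hom, ?_, ?_, ?_, ?_⟩
  · intro i; rw [map_mul, v0, mul_zero]
  · refine not_mem_W3 (ev w) ?_ ?_ ?_ ?_ <;> rw [ev_apply]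
    · simp [h1]
    · simp [h1]
    · simp [h2]
    · exact hfw.ne'
  · intro x hx x1 x2
    obtain ⟨t, rfl⟩ := smul_of_not_np (hw 0).ne_left (bez_pp hA hP hw hx h1 h2 x1 x2)
    have ht : t ≠ 0 := by
      rintro rfl
      exact (hx 0).ne_left (by simp)
    rw [hom_ev hom]
    positivity
  · intro i
    refine local_tr (hP.vp i) (hP.vq i) (hT i) ?_ ?_
    · rw [map_mul, v0, mul_zero]
    · intro u; rw [← smul_eq_C_mul, map_smul, v1, smul_zero]

/-- second directional derivative -/
def d2 (a v : Pt) : R3 →ₗ[ℝ] ℝ := dd a v ∘ₗ (∑ k, v k • (pderiv k).toLinearMap)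

lemma d2_mul (a v : Pt) {r s : R3} (hr : eval a r = 0) (hs : eval a s = 0) :
    d2 a v (r * s) = 2 * (dd a v r * dd a v s) := by
  have h : (∑ k, v k • (pderiv k).toLinearMap : R3 →ₗ[ℝ] R3) (r * s)
      = ∑ k, v k • (pderiv k r * s + r * pderiv k s) := by
    rw [LinearMap.sum_apply]
    refine Finset.sum_congr rfl fun k _ => ?_
    rw [LinearMap.smul_apply]
    exact congrArg (fun z => v k • z) pderiv_mul
  rw [d2, LinearMap.comp_apply, h, map_sum]
  simp only [map_smul, map_add, dd_mul, hr, hs, smul_eq_mul]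
  rw [dd_apply a v r, dd_apply a v s]
  simp only [Fin.sum_univ_three]
  ring

lemma smul_of_dp {a u v : Pt} (ha : a ≠ 0) (hu : dp a u = 0) (hv : dp a v = 0) (hv0 : v ≠ 0)
    (h : dt a u v = 0) : ∃ c : ℝ, u = c • v := by
  apply smul_of_not_np hv0
  intro hnp
  obtain ⟨k, hk⟩ := lin_eq_ln hnp (lin_hom a) (by rw [eval_lin]; exact hv) (by rw [eval_lin]; exact hu)
  have h1 := congrArg (eval a) hk
  rw [eval_lin, map_mul, eval_ln] at h1
  have h2 : dt v u a = 0 := by rw [dt] at h ⊢; linear_combination -h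
  rw [h2, mul_zero] at h1
  exact (dp_self ha).ne' h1

lemma two_others (i : Fin 8) : ∃ a b : Fin 8, a ≠ b ∧ i ≠ a ∧ i ≠ b := by
  revert i; decide

lemma case_tan (hA : GP A) (hP : Pencil A p q) (i : Fin 8) {v : Pt} (hv : dp (A i) v = 0) (hv0 : v ≠ 0)
    (h1 : dd (A i) v p = 0) (h2 : dd (A i) v q = 0) : ∃ f, Good A p q f := by
  have hnp := np_of_dp (hA.ne i) hv hv0
  have hT : ∀ k, i ≠ k → Tr (A k) p q := by
    intro k hk u hu hp hq
    by_contra h0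
    exact bez_tt hA hP i k hk hnp (np_of_dp (hA.ne k) hu h0) h1 h2 hp hq
  obtain ⟨a, b, hab, hia, hib⟩ := two_others i
  obtain ⟨c, e, hc, he, c0, e0, v0, v1, v2⟩ := pair hP hab (hT a hia) (hT b hib) (dd (A i) v) h1 h2
    (sep_tangent hA i a hia v hnp) (sep_tangent hA i b hib v hnp)
  obtain ⟨ci, ei⟩ := v2 i hia hib
  obtain ⟨σ, hσ⟩ : ∃ σ, σ = dd (A i) v c * dd (A i) v e := ⟨_, rfl⟩
  have hσ0 : σ ≠ 0 := by rw [hσ]; exact mul_ne_zero c0 e0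
  refine ⟨C σ * (c * e), (hc.mul he).C_mul _, ?_, ?_, ?_, ?_⟩
  · intro i; rw [map_mul, v0, mul_zero]
  · refine not_mem_W3 (d2 (A i) v) ?_ ?_ ?_ ?_
    · rw [d2_mul _ _ (hP.vp i) (hP.vp i), h1]; simp
    · rw [d2_mul _ _ (hP.vp i) (hP.vq i), h1]; simp
    · rw [d2_mul _ _ (hP.vq i) (hP.vq i), h2]; simp
    · rw [← smul_eq_C_mul, map_smul, d2_mul _ _ ci ei, ← hσ]
      simpa using hσ0
  · intro x hx x1 x2
    exact (bez_pt hA hP hx i hnp x1 x2 h1 h2).elim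
  · intro k
    by_cases hk : i = k
    · subst hk
      obtain ⟨K, hK, hKu⟩ := taylor_prod (A i) c e ci ei
      refine local_slice (hP.vp i) (hP.vq i) (fun u => σ * (dd (A i) u c * dd (A i) u e)) ?_ ?_
        (|σ| * K) (by positivity) ?_ ?_
      · exact continuous_const.mul ((dd_cont _ _).mul (dd_cont _ _))
      · intro t u
        simp only [dd_smul]; ring
      · intro u hu
        have h3 := hKu u hu
        have h4 : |σ * (eval (A i + u) c * eval (A i + u) e - dd (A i) u c * dd (A i) u e)|
            ≤ |σ| * (K * ‖u‖ ^ 3) := by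
          rw [abs_mul]; exact mul_le_mul_of_nonneg_left h3 (abs_nonneg _)
        have h5 := (abs_le.mp h4).1
        rw [map_mul, map_mul, eval_C]
        linarith
      · intro u hu0 hu u1 u2
        have h3 : dt (A i) u v = 0 := by
          by_contra h3
          exact bez_t hA hP i h3 u1 u2 h1 h2
        obtain ⟨t, rfl⟩ := smul_of_dp (hA.ne i) hu hv hv0 h3
        have ht : t ≠ 0 := by rintro rfl; simp at hu0
        have : σ * (dd (A i) (t • v) c * dd (A i) (t • v) e) = (t * σ) ^ 2 := by
          rw [dd_smul, dd_smul, hσ]; ring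
        simp only [this]
        positivity
    · refine local_tr (hP.vp k) (hP.vq k) (hT k hk) ?_ ?_
      · rw [map_mul, v0, mul_zero]
      · intro u; rw [← smul_eq_C_mul, map_smul, v1, smul_zero]

lemma exists_out {V U : Type*} [AddCommGroup V] [Module ℝ V] [AddCommGroup U] [Module ℝ U]
    (H : Submodule ℝ V) [Module.Finite ℝ H] [Module.Finite ℝ U] (Φ : V →ₗ[ℝ] U) (S : Finset V)
    (h : Module.finrank ℝ U + S.card < Module.finrank ℝ H) :
    ∃ f ∈ H, Φ f = 0 ∧ f ∉ Submodule.span ℝ (S : Set V) := by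
  by_contra hcon
  push Not at hcon
  obtain ⟨W, hW⟩ : ∃ W : Submodule ℝ V, W = Submodule.span ℝ (S : Set V) := ⟨_, rfl⟩
  haveI : Module.Finite ℝ W := by rw [hW]; infer_instance
  obtain ⟨π, hπ⟩ := LinearMap.exists_leftInverse_of_injective W.subtype (Submodule.ker_subtype W)
  have hi : Function.Injective ((Φ.prod π) ∘ₗ H.subtype) := by
    rw [injective_iff_map_eq_zero]
    rintro ⟨x, hx⟩ h0
    have h1 : (Φ x, π x) = 0 := h0
    have h2 := hcon x hx (congrArg Prod.fst h1)
    rw [← hW] at h2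
    have h3 := LinearMap.congr_fun hπ ⟨x, h2⟩
    have h4 : π x = ⟨x, h2⟩ := h3
    have h5 : π x = 0 := congrArg Prod.snd h1
    rw [h5] at h4
    have h6 := congrArg Subtype.val h4
    exact Subtype.ext h6.symm
  have h1 := LinearMap.finrank_le_finrank_of_injective hi
  rw [Module.finrank_prod] at h1
  have h2 : Module.finrank ℝ W ≤ S.card := by rw [hW]; exact finrank_span_finset_le_card S
  omega

lemma case_none (hP : Pencil A p q) (hT : ∀ i, Tr (A i) p q)
    (hx : ∀ x : Pt, (∀ i, Np x (A i)) → eval x p = 0 → eval x q = 0 → False) : ∃ f, Good A p q f := by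
  classical
  let Φ : R3 →ₗ[ℝ] ((Fin 8 × Fin 3) → ℝ) := LinearMap.pi fun ik => ev (A ik.1) ∘ₗ (pderiv ik.2).toLinearMap
  have hcard : ({p * p, p * q, q * q} : Finset R3).card ≤ 3 := Finset.card_le_three
  obtain ⟨f, hf, hΦ, hW⟩ := exists_out (HH 6) Φ {p * p, p * q, q * q} (by
    rw [finrank_HH, Module.finrank_fintype_fun_eq_card, Fintype.card_prod, Fintype.card_fin, Fintype.card_fin]
    have : (6 + 2).choose 6 = 28 := by decide
    omega)
  have hf6 : f.IsHomogeneous 6 := hf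
  have hd : ∀ i k, eval (A i) (pderiv k f) = 0 := by
    intro i k
    have := congrFun hΦ (i, k)
    simpa [Φ, ev_apply] using this
  have hv : ∀ i, eval (A i) f = 0 := fun i => euler (by norm_num) hf6 (hd i)
  refine ⟨f, hf6, hv, by simpa [W3] using hW, fun x h1 h2 h3 => (hx x h1 h2 h3).elim, fun i => ?_⟩
  exact local_tr (hP.vp i) (hP.vq i) (hT i) (hv i) (fun u => by simp [dd_apply, hd])

lemma exists_good (hA : GP A) (hP : Pencil A p q) : ∃ f, Good A p q f := by
  by_cases hx : ∃ w : Pt, (∀ i, Np w (A i)) ∧ eval w p = 0 ∧ eval w q = 0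
  · obtain ⟨w, hw, h1, h2⟩ := hx
    exact case_ext hA hP hw h1 h2
  · by_cases hT : ∀ i, Tr (A i) p q
    · exact case_none hP hT fun x h1 h2 h3 => hx ⟨x, h1, h2, h3⟩
    · simp only [Tr] at hT
      push Not at hT
      obtain ⟨i, v, hv, h1, h2, h0⟩ := hT
      exact case_tan hA hP i hv h0 h1 h2

lemma exists_g (hA : GP A) : ∃ g : R3, g.IsHomogeneous 6 ∧ Psd g ∧ (∀ i, eval (A i) g = 0) ∧ ¬ Sos g := by
  obtain ⟨p, q, hP⟩ := exists_pencil hA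
  obtain ⟨f, hf⟩ := exists_good hA hP
  obtain ⟨ε, hε, hpsd⟩ := psd_of hA hP hf.hom hf.ext hf.loc
  refine ⟨p ^ 2 + q ^ 2 + C ε * f, ((hP.hp.pow 2).add (hP.hq.pow 2)).add (hf.hom.C_mul ε), hpsd, ?_,
    not_sos hP hf.hom hf.van hf.out hε⟩
  intro i; simp [hP.vp, hP.vq, hf.van]

lemma card_le {T : Set P2} (e : Fin 8 ≃ T) {l : R3} {n : ℕ} (h : {P ∈ T | VanishAt l P}.encard ≤ n)
    (s : Finset (Fin 8)) (hs : ∀ i ∈ s, eval (e i).1.rep l = 0) : s.card ≤ n := by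
  have hinj : Function.Injective fun i => (e i).1 := Subtype.val_injective.comp e.injective
  have h1 : (fun i => (e i).1) '' (s : Set (Fin 8)) ⊆ {P ∈ T | VanishAt l P} := by
    rintro _ ⟨i, hi, rfl⟩
    exact ⟨(e i).2, hs i hi⟩
  have h2 := (Set.encard_le_encard h1).trans h
  rw [hinj.encard_image, Set.encard_coe_eq_coe_finsetCard] at h2
  exact_mod_cast h2

lemma gp_of {T : Set P2} (e : Fin 8 ≃ T) (hgen : GenPos T) : GP fun i => (e i).1.rep where
  np := by
    intro i j hij
    by_contra h
    obtain ⟨c, hc⟩ := smul_of_not_np (Projectivization.rep_nonzero (e i).1) h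
    apply hij
    apply e.injective
    apply Subtype.ext
    rw [← Projectivization.mk_rep (e i).1, ← Projectivization.mk_rep (e j).1, eq_comm,
      Projectivization.mk_eq_mk_iff']
    exact ⟨c, hc.symm⟩
  line := fun l h0 hl s hs => card_le e (by exact_mod_cast hgen.1 l h0 hl) s hs
  conic := fun c h0 hc s hs => card_le e (by exact_mod_cast hgen.2 c h0 hc) s hs

end

/-- For any 8 points in `ℙ²(ℝ)`, no 4 on a line and no 7 on a conic, there is a psd
sextic form vanishing on them that is not a sum of squares. -/
theorem statement0 (T : Set P2) (hT8 : T.encard = 8) (hgen : GenPos T) :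
    ∃ g : MvPolynomial (Fin 3) ℝ, g.IsHomogeneous 6 ∧ Psd g ∧
      (∀ P ∈ T, VanishAt g P) ∧ ¬ Sos g := by
  have hfin : T.Finite := Set.finite_of_encard_eq_coe (k := 8) (by exact_mod_cast hT8)
  haveI : Finite T := hfin
  have hn : Nat.card T = 8 := by
    rw [Nat.card_coe_set_eq, Set.ncard, hT8]; rfl
  let e : Fin 8 ≃ T := (Finite.equivFinOfCardEq hn).symm
  obtain ⟨g, h1, h2, h3, h4⟩ := exists_g (gp_of e hgen)
  refine ⟨g, h1, h2, fun P hP => ?_, h4⟩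
  have := h3 (e.symm ⟨P, hP⟩)
  simpa [VanishAt] using this

end
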